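/- arXiv:1707.04004 — 12 statements merged into one kernel-verified Lean document; each statement's English description precedes it below -/
import Mathlib

section
/- Let p be a prime, q ≥ 3 a power of p, and F_{q²} the finite field with q² elements. The set G₁ of 3×3 matrices of the form [[1, a^q, b], [0, 1, a], [0, 0, 1]] with a, b ∈ F_{q²} satisfying b^q + b = a^{q+1} is a subgroup of GL(3, F_{q²}), and its cardinality is q³. -/
theorem herm_card_aux {F : Type} [Field F] [Fintype F] (q : ℕ) (hq3 : 3 ≤ q)
    (hF : Fintype.card F = q ^ 2) (T : F →+ F) (hT : ∀ b, T b = b ^ q + b) 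
    (hadd : ∀ x y : F, (x + y) ^ q = x ^ q + y ^ q) (hqq : ∀ x : F, (x ^ q) ^ q = x) :
    Nat.card T.ker = q ∧ ∀ y : F, y ^ q = y → ∃ b, T b = y := by
  classical
  have root : ∀ (c : F) (S : Set F), (∀ x ∈ S, x ^ q + c * x = 0) → Nat.card S ≤ q := by
    intro c S hS
    have hdeg : (Polynomial.C c * Polynomial.X : Polynomial F).degree < (q : WithBot ℕ) := by
      refine lt_of_le_of_lt (Polynomial.degree_C_mul_X_le c) ?_
      exact_mod_cast (by omega : 1 < q)
    have hm : (Polynomial.X ^ q + Polynomial.C c * Polynomial.X : Polynomial F).Monic :=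
      Polynomial.monic_X_pow_add hdeg
    have hnd : (Polynomial.X ^ q + Polynomial.C c * Polynomial.X : Polynomial F).natDegree = q :=
      Polynomial.natDegree_eq_of_degree_eq_some (by
        rw [Polynomial.degree_add_eq_left_of_degree_lt (by rwa [Polynomial.degree_X_pow])]
        exact Polynomial.degree_X_pow q)
    have hsub : S ⊆ ((Polynomial.X ^ q + Polynomial.C c * Polynomial.X : Polynomial F).roots.toFinset : Set F) := by
      intro x hx
      simp only [Finset.mem_coe, Multiset.mem_toFinset]
      rw [Polynomial.mem_roots hm.ne_zero]
      simp [Polynomial.IsRoot, hS x hx]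
    rw [Nat.card_coe_set_eq]
    refine (Set.ncard_le_ncard hsub (Finset.finite_toSet _)).trans ?_
    rw [Set.ncard_coe_finset]
    refine (Multiset.toFinset_card_le _).trans ((Polynomial.card_roots' _).trans hnd.le)
  have h1 : Nat.card T.ker ≤ q := root 1 (T.ker : Set F) (by
    intro x hx
    have : T x = 0 := hx
    rw [hT] at this
    simpa using this)
  have hfix := root (-1) {x | x ^ q = x} (by intro x hx; have : x ^ q = x := hx; rw [this]; ring)
  have hsub : (T.range : Set F) ⊆ {x | x ^ q = x} := by
    rintro _ ⟨b, rfl⟩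
    simp only [Set.mem_setOf_eq, hT, hadd, hqq]
    ring
  have h2 : Nat.card T.range ≤ q :=
    (Nat.card_mono (Set.toFinite _) hsub).trans hfix
  have hmul : Nat.card T.ker * Nat.card T.range = q ^ 2 := by
    rw [← hF, ← Nat.card_eq_fintype_card, ← AddSubgroup.card_mul_index T.ker, AddSubgroup.index_ker]
  have h3 : Nat.card T.ker = q := by nlinarith
  have h4 : Nat.card T.range = q := by nlinarith
  refine ⟨h3, fun y hy => ?_⟩
  have he : (T.range : Set F) = {x | x ^ q = x} := by
    apply Set.eq_of_subset_of_ncard_le hsub _ (Set.toFinite _)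
    rw [← Nat.card_coe_set_eq, ← Nat.card_coe_set_eq]
    exact hfix.trans h4.ge
  have : y ∈ (T.range : Set F) := he ▸ hy
  exact this

/-- Let `p` be a prime, `q ≥ 3` a power of `p`, and `F` the finite field with `q²` elements.
The set of unipotent upper-triangular matrices `[[1, a^q, b], [0, 1, a], [0, 0, 1]]` with
`b^q + b = a^(q+1)` is (the underlying set of) a subgroup of `GL(3, F)` of order `q³`. -/
theorem hermitian_unipotent_subgroup (p q : ℕ) (hp : p.Prime)
    (hq : ∃ n : ℕ, 0 < n ∧ q = p ^ n) (hq3 : 3 ≤ q)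
    (F : Type) [Field F] [Fintype F] (hF : Fintype.card F = q ^ 2) :
    ∃ G : Subgroup (Matrix.GeneralLinearGroup (Fin 3) F),
      ((fun M : Matrix.GeneralLinearGroup (Fin 3) F => (M : Matrix (Fin 3) (Fin 3) F)) ''
          (G : Set (Matrix.GeneralLinearGroup (Fin 3) F)) =
        {A : Matrix (Fin 3) (Fin 3) F | ∃ a b : F, b ^ q + b = a ^ (q + 1) ∧
          A = !![1, a ^ q, b; 0, 1, a; 0, 0, 1]}) ∧
      Nat.card G = q ^ 3 := by
  classical
  obtain ⟨n, hn, hqn⟩ := hq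
  haveI : Fact p.Prime := ⟨hp⟩
  haveI : CharP F p := charP_of_card_eq_prime_pow (f := n * 2) (by rw [hF, hqn, pow_mul])
  have hadd : ∀ x y : F, (x + y) ^ q = x ^ q + y ^ q := by
    intro x y; rw [hqn]; exact add_pow_char_pow x y p n
  have hqq : ∀ x : F, (x ^ q) ^ q = x := by
    intro x; rw [← pow_mul, ← sq, ← hF]; exact FiniteField.pow_card x
  have h0 : (0 : F) ^ q = 0 := zero_pow (by omega)
  have hneg : ∀ x : F, (-x) ^ q = -x ^ q := by
    intro x
    have := hadd x (-x)
    rw [add_neg_cancel, h0] at this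
    exact (neg_eq_of_add_eq_zero_right this.symm).symm
  let T : F →+ F :=
    { toFun := fun b => b ^ q + b
      map_zero' := by simp [h0]
      map_add' := by intro x y; simp only [hadd]; ring }
  have hT : ∀ b, T b = b ^ q + b := fun _ => rfl
  obtain ⟨hker, hsurj⟩ := herm_card_aux q hq3 hF T hT hadd hqq
  let m : F → F → Matrix (Fin 3) (Fin 3) F := fun a b => !![1, a ^ q, b; 0, 1, a; 0, 0, 1]
  have mmul : ∀ a b c d, m a b * m c d = m (a + c) (d + a ^ q * c + b) := by
    intro a b c d
    simp only [m, hadd]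
    ext i j
    fin_cases i <;> fin_cases j <;> simp [Matrix.mul_apply, Fin.sum_univ_three] <;> ring
  have m1 : m 0 0 = 1 := by
    simp only [m, h0]
    ext i j
    fin_cases i <;> fin_cases j <;> simp
  let u : F → F → Matrix.GeneralLinearGroup (Fin 3) F := fun a b =>
    ⟨m a b, m (-a) (a ^ q * a - b), by rw [mmul, ← m1]; congr 1 <;> ring,
      by rw [mmul, ← m1, hneg]; congr 1 <;> ring⟩
  have hu : ∀ a b, ((u a b : Matrix.GeneralLinearGroup (Fin 3) F) : Matrix (Fin 3) (Fin 3) F) = m a b :=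
    fun _ _ => rfl
  have huinj : ∀ a b c d, u a b = u c d → a = c ∧ b = d := by
    intro a b c d h
    have h : m a b = m c d := congrArg Units.val h
    have h1 := congrFun (congrFun h 1) 2
    have h2 := congrFun (congrFun h 0) 2
    simp [m] at h1 h2
    exact ⟨h1, h2⟩
  let G : Subgroup (Matrix.GeneralLinearGroup (Fin 3) F) :=
    { carrier := {M | ∃ a b : F, b ^ q + b = a ^ (q + 1) ∧ M = u a b}
      one_mem' := ⟨0, 0, by simp [h0], Units.ext (by rw [hu, m1]; rfl)⟩
      mul_mem' := by
        rintro _ _ ⟨a, b, h, rfl⟩ ⟨c, d, h', rfl⟩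
        refine ⟨a + c, d + a ^ q * c + b, ?_, Units.ext (mmul a b c d)⟩
        rw [pow_succ] at *
        simp only [hadd, mul_pow, hqq]
        linear_combination h + h'
      inv_mem' := by
        rintro _ ⟨a, b, h, rfl⟩
        refine ⟨-a, a ^ q * a - b, ?_, Units.ext rfl⟩
        rw [pow_succ] at *
        simp only [sub_eq_add_neg, hadd, hneg, mul_pow, hqq]
        linear_combination -h }
  refine ⟨G, ?_, ?_⟩
  · ext A
    constructor
    · rintro ⟨_, ⟨a, b, h, rfl⟩, rfl⟩
      exact ⟨a, b, h, rfl⟩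
    · rintro ⟨a, b, h, rfl⟩
      exact ⟨u a b, ⟨a, b, h, rfl⟩, rfl⟩
  · have hb : ∀ a : F, ∃ b, T b = a ^ (q + 1) := by
      intro a
      apply hsurj
      rw [pow_succ, mul_pow, hqq, mul_comm]
    choose b0 hb0 using hb
    let f : F × T.ker → G := fun x => ⟨u x.1 (b0 x.1 + x.2), x.1, b0 x.1 + x.2, by
      rw [← hT, map_add, hb0, (AddMonoidHom.mem_ker).1 x.2.2, add_zero], rfl⟩
    have hf : Function.Bijective f := by
      constructor
      · rintro ⟨a, k⟩ ⟨c, l⟩ h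
        obtain ⟨h1, h2⟩ := huinj _ _ _ _ (congrArg Subtype.val h)
        simp only at h1 h2
        subst h1
        have := add_left_cancel h2
        rw [Subtype.ext this]
      · rintro ⟨_, a, b, h, rfl⟩
        refine ⟨(a, ⟨b - b0 a, ?_⟩), Subtype.ext ?_⟩
        · rw [AddMonoidHom.mem_ker, map_sub, hb0, hT, h, sub_self]
        · simp [f]
    rw [← Nat.card_eq_of_bijective f hf, Nat.card_prod, hker, Nat.card_eq_fintype_card, hF]
    ring
end

section
/- Let p be a prime, q ≥ 3 a power of p, and F_{q²} the finite field with q² elements. The set {(x, y) ∈ F_{q²} × F_{q²} : x^q + x = y^{q+1}} has exactly q³ elements. -/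
open Polynomial in
lemma herm_card_le (F : Type) [Field F] [Fintype F] (q : ℕ) (hq : 2 ≤ q) (c : F) :
    Nat.card {x : F // x ^ q + c * x = 0} ≤ q := by
  classical
  have hd : (C c * X : F[X]).degree < (q : ℕ) := by
    refine lt_of_le_of_lt (degree_C_mul_X_le c) ?_
    exact_mod_cast (by omega : 1 < q)
  have hm : (X ^ q + C c * X : F[X]).Monic := monic_X_pow_add hd
  have hn : (X ^ q + C c * X : F[X]).natDegree = q := by
    apply natDegree_eq_of_degree_eq_some
    rw [degree_add_eq_left_of_degree_lt] <;> simp only [degree_X_pow]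
    exact hd
  rw [Nat.card_eq_fintype_card, Fintype.card_subtype]
  calc _ ≤ (X ^ q + C c * X : F[X]).roots.toFinset.card := by
        apply Finset.card_le_card
        intro x hx
        simp only [Finset.mem_filter, Finset.mem_univ, true_and] at hx
        rw [Multiset.mem_toFinset, mem_roots hm.ne_zero]
        simpa [IsRoot] using hx
    _ ≤ _ := Multiset.toFinset_card_le _
    _ ≤ _ := card_roots' _
    _ = q := hn

/-- Let `p` be a prime, `q ≥ 3` a power of `p`, and `F` the finite field with `q²` elements.
The affine Hermitian curve `x^q + x = y^(q+1)` has exactly `q³` points over `F`. -/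
theorem hermitian_affine_point_count (p q : ℕ) (hp : p.Prime)
    (hq : ∃ n : ℕ, 0 < n ∧ q = p ^ n) (hq3 : 3 ≤ q)
    (F : Type) [Field F] [Fintype F] (hF : Fintype.card F = q ^ 2) :
    Nat.card {P : F × F // P.1 ^ q + P.1 = P.2 ^ (q + 1)} = q ^ 3 := by
  obtain ⟨n, hn, hqn⟩ := hq
  have : Fact p.Prime := ⟨hp⟩
  have : CharP F p := charP_of_card_eq_prime_pow (f := n * 2) (by
    rw [hF, hqn, pow_mul])
  have hadd : ∀ a b : F, (a + b) ^ q = a ^ q + b ^ q := by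
    intro a b; rw [hqn]; exact add_pow_char_pow a b p n
  have hqq : ∀ a : F, (a ^ q) ^ q = a := by
    intro a; rw [← pow_mul, ← sq, ← hF]; exact FiniteField.pow_card a
  let T : F →+ F :=
    { toFun := fun x => x ^ q + x
      map_zero' := by simp; omega
      map_add' := by intro a b; simp only [hadd]; ring }
  have hT : ∀ x, T x = x ^ q + x := fun _ => rfl
  have hker : Nat.card T.ker ≤ q := by
    refine le_trans (le_of_eq ?_) (herm_card_le F q (by omega) 1)
    exact Nat.card_congr (Equiv.subtypeEquivRight (by intro x; rw [AddMonoidHom.mem_ker, hT, one_mul]))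
  let S : Set F := {x | x ^ q + (-1) * x = 0}
  have hS : S.ncard ≤ q := herm_card_le F q (by omega) (-1)
  have hsub : (T.range : Set F) ⊆ S := by
    rintro _ ⟨x, rfl⟩
    simp only [S, Set.mem_ofPred_eq, hT, hadd, hqq]; ring
  have hprod : Nat.card T.ker * (T.range : Set F).ncard = q ^ 2 := by
    have h := T.ker.card_mul_index
    rw [AddSubgroup.index_ker, Nat.card_eq_fintype_card (α := F), hF] at h
    exact h
  have hle : (T.range : Set F).ncard ≤ S.ncard := Set.ncard_le_ncard hsub (Set.toFinite _)
  have hk : Nat.card T.ker = q := by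
    by_contra h
    have : Nat.card T.ker < q := lt_of_le_of_ne hker h
    nlinarith
  have hr : (T.range : Set F).ncard = q := by
    rw [hk, sq] at hprod
    exact Nat.eq_of_mul_eq_mul_left (by omega) hprod
  have hSeq : (T.range : Set F) = S :=
    Set.eq_of_subset_of_ncard_le hsub (by omega) (Set.toFinite _)
  have hex : ∀ y : F, ∃ x, T x = y ^ (q + 1) := by
    intro y
    have : y ^ (q + 1) ∈ S := by
      simp only [S, Set.mem_ofPred_eq]
      rw [pow_succ, mul_pow, hqq]; ring
    rw [← hSeq] at this
    exact this
  choose g hg using hex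
  let e : {P : F × F // P.1 ^ q + P.1 = P.2 ^ (q + 1)} ≃ T.ker × F :=
    { toFun := fun P => (⟨P.1.1 - g P.1.2, by
        rw [AddMonoidHom.mem_ker, map_sub, hg, hT, P.2, sub_self]⟩, P.1.2)
      invFun := fun z => ⟨(z.1.1 + g z.2, z.2), by
        have h := z.1.2
        rw [AddMonoidHom.mem_ker] at h
        have := map_add T z.1.1 (g z.2)
        rw [h, hg, zero_add, hT] at this
        exact this⟩
      left_inv := by rintro ⟨⟨x, y⟩, h⟩; simp
      right_inv := by rintro ⟨⟨x, hx⟩, y⟩; simp }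
  rw [Nat.card_congr e, Nat.card_prod, hk, Nat.card_eq_fintype_card, hF]
  ring
end

section
/- Let k be an algebraically closed field of characteristic p > 0 and q ≥ 3 a power of p. Let K = Frac(k[X, Y]/(X^q + X − Y^{q+1})) be the function field of the Hermitian curve, with x, y ∈ K the images of X, Y. Then K is a finite Galois extension of its subfield k(y^{q²} − y) (the subfield generated over k by the element y^{q²} − y), and [K : k(y^{q²} − y)] = q³. -/
set_option synthInstance.maxHeartbeats 1000000
set_option maxHeartbeats 2000000

/-- The affine coordinate ring `k[X, Y]/(X^q + X − Y^(q+1))` of the Hermitian curve. -/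
noncomputable abbrev HermitianRing (k : Type) [Field k] (q : ℕ) : Type :=
  MvPolynomial (Fin 2) k ⧸
    (Ideal.span {MvPolynomial.X 0 ^ q + MvPolynomial.X 0 - MvPolynomial.X 1 ^ (q + 1)} :
      Ideal (MvPolynomial (Fin 2) k))

/-- The function field `K = Frac(k[X, Y]/(X^q + X − Y^(q+1)))` of the Hermitian curve. -/
noncomputable abbrev HermitianFunctionField (k : Type) [Field k] (q : ℕ) : Type :=
  FractionRing (HermitianRing k q)

/-- The image `x ∈ K` of `X`. -/
noncomputable def hermitianX (k : Type) [Field k] (q : ℕ) : HermitianFunctionField k q :=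
  algebraMap (HermitianRing k q) (HermitianFunctionField k q)
    (Ideal.Quotient.mk _ (MvPolynomial.X 0))

/-- The image `y ∈ K` of `Y`. -/
noncomputable def hermitianY (k : Type) [Field k] (q : ℕ) : HermitianFunctionField k q :=
  algebraMap (HermitianRing k q) (HermitianFunctionField k q)
    (Ideal.Quotient.mk _ (MvPolynomial.X 1))

open Polynomial in
theorem herm_upper {F K : Type} [Field F] [Field K] [Algebra F K] (x y : K) (m n : ℕ)
    (P : F[X]) (hP : P.Monic) (hPd : P.natDegree = m) (hPy : aeval y P = 0)
    (Q : (IntermediateField.adjoin F {y})[X]) (hQ : Q.Monic) (hQd : Q.natDegree = n)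
    (hQx : aeval x Q = 0)
    (htop : ∀ S : Subfield K, (∀ c : F, algebraMap F K c ∈ S) → x ∈ S → y ∈ S → S = ⊤) :
    FiniteDimensional F K ∧ Module.finrank F K ≤ m * n := by
  have iy : IsIntegral F y := ⟨P, hP, hPy⟩
  have ix : IsIntegral (IntermediateField.adjoin F {y}) x := ⟨Q, hQ, hQx⟩
  have h1 := IntermediateField.adjoin.finiteDimensional iy
  have h2 := IntermediateField.adjoin.finiteDimensional ix
  have e1 := IntermediateField.adjoin.finrank iy
  have e2 := IntermediateField.adjoin.finrank ix
  have l1 : (minpoly F y).natDegree ≤ m := by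
    rw [← hPd]; exact natDegree_le_of_dvd (minpoly.dvd _ _ hPy) hP.ne_zero
  have l2 : (minpoly (IntermediateField.adjoin F {y}) x).natDegree ≤ n := by
    rw [← hQd]; exact natDegree_le_of_dvd (minpoly.dvd _ _ hQx) hQ.ne_zero
  have ht : IntermediateField.adjoin (IntermediateField.adjoin F {y}) {x} = ⊤ := by
    have := htop (IntermediateField.adjoin (IntermediateField.adjoin F {y}) {x}).toSubfield
      (fun c => by
        rw [IsScalarTower.algebraMap_apply F (IntermediateField.adjoin F {y}) K]
        exact IntermediateField.algebraMap_mem _ _)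
      (IntermediateField.mem_adjoin_simple_self _ x)
      (IntermediateField.algebraMap_mem (IntermediateField.adjoin (IntermediateField.adjoin F {y}) {x})
        ⟨y, IntermediateField.mem_adjoin_simple_self F y⟩)
    rw [eq_top_iff]
    intro z _
    have hz : z ∈ (⊤ : Subfield K) := trivial
    rw [← this] at hz
    exact hz
  rw [ht] at h2 e2
  have h3 : FiniteDimensional (IntermediateField.adjoin F {y}) K :=
    IntermediateField.topEquiv.toLinearEquiv.finiteDimensional
  rw [IntermediateField.finrank_top'] at e2
  refine ⟨FiniteDimensional.trans F (IntermediateField.adjoin F {y}) K, ?_⟩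
  rw [← Module.finrank_mul_finrank F (IntermediateField.adjoin F {y}) K, e1, e2]
  exact Nat.mul_le_mul l1 l2

theorem herm_top (k : Type) [Field k] (q : ℕ) [IsDomain (HermitianRing k q)]
    (S : Subfield (HermitianFunctionField k q))
    (hc : ∀ c : k, algebraMap k _ c ∈ S) (hx : hermitianX k q ∈ S) (hy : hermitianY k q ∈ S) :
    S = ⊤ := by
  have h : ∀ r : HermitianRing k q, algebraMap _ (HermitianFunctionField k q) r ∈ S := by
    intro r
    obtain ⟨r, rfl⟩ := Ideal.Quotient.mk_surjective r
    induction r using MvPolynomial.induction_on with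
    | C a => exact hc a
    | add p q hp hq => rw [map_add, map_add]; exact S.add_mem hp hq
    | mul_X p i hp =>
      rw [map_mul, map_mul]
      refine S.mul_mem hp ?_
      fin_cases i
      · exact hx
      · exact hy
  rw [eq_top_iff]
  intro z _
  obtain ⟨a, b, _, rfl⟩ := IsFractionRing.div_surjective (A := HermitianRing k q) z
  exact S.div_mem (h a) (h b)

theorem herm_eq (k : Type) [Field k] (q : ℕ) :
    (Ideal.Quotient.mk _ (MvPolynomial.X 0) : HermitianRing k q) ^ q
      + Ideal.Quotient.mk _ (MvPolynomial.X 0) =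
    (Ideal.Quotient.mk _ (MvPolynomial.X 1)) ^ (q + 1) := by
  rw [← sub_eq_zero, ← map_pow, ← map_pow, ← map_add, ← map_sub, Ideal.Quotient.eq_zero_iff_mem]
  exact Ideal.subset_span rfl

theorem hermK_eq (k : Type) [Field k] (q : ℕ) :
    hermitianX k q ^ q + hermitianX k q = hermitianY k q ^ (q + 1) := by
  have := congrArg (algebraMap _ (HermitianFunctionField k q)) (herm_eq k q)
  rw [map_add, map_pow, map_pow] at this
  exact this

noncomputable def hermHom (k : Type) [Field k] (q : ℕ) {A : Type} [CommRing A] [Algebra k A]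
    (x y : A) (h : x ^ q + x = y ^ (q + 1)) : HermitianRing k q →ₐ[k] A :=
  Ideal.Quotient.liftₐ _ (MvPolynomial.aeval ![x, y]) (by
    intro a ha
    have : Ideal.span {MvPolynomial.X 0 ^ q + MvPolynomial.X 0 - MvPolynomial.X 1 ^ (q + 1)} ≤
      RingHom.ker (MvPolynomial.aeval (R := k) ![x, y]) := by
      rw [Ideal.span_le, Set.singleton_subset_iff]
      simp [RingHom.mem_ker, h]
    exact this ha)

theorem hermHom_X (k : Type) [Field k] (q : ℕ) {A : Type} [CommRing A] [Algebra k A]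
    (x y : A) (h : x ^ q + x = y ^ (q + 1)) :
    hermHom k q x y h (Ideal.Quotient.mk _ (MvPolynomial.X 0)) = x :=
  MvPolynomial.aeval_X ![x, y] 0

theorem hermHom_Y (k : Type) [Field k] (q : ℕ) {A : Type} [CommRing A] [Algebra k A]
    (x y : A) (h : x ^ q + x = y ^ (q + 1)) :
    hermHom k q x y h (Ideal.Quotient.mk _ (MvPolynomial.X 1)) = y :=
  MvPolynomial.aeval_X ![x, y] 1

theorem herm_ext (k : Type) [Field k] (q : ℕ) {A : Type} [CommRing A] [Algebra k A]
    (f g : HermitianRing k q →ₐ[k] A)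
    (hx : f (Ideal.Quotient.mk _ (MvPolynomial.X 0)) = g (Ideal.Quotient.mk _ (MvPolynomial.X 0)))
    (hy : f (Ideal.Quotient.mk _ (MvPolynomial.X 1)) = g (Ideal.Quotient.mk _ (MvPolynomial.X 1))) :
    f = g := by
  apply Ideal.Quotient.algHom_ext
  apply MvPolynomial.algHom_ext
  intro i
  fin_cases i
  · exact hx
  · exact hy

theorem herm_param (k : Type) [Field k] (p : ℕ) (hp : p.Prime) [CharP k p] (q n : ℕ)
    (hq : q = p ^ n) {A : Type} [CommRing A] [Nontrivial A] [Algebra k A] (x y : A)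
    (h : x ^ q + x = y ^ (q + 1)) (a b : k) (ha : a ^ q ^ 2 = a) (hb : b ^ q + b = a ^ (q + 1)) :
    (x + algebraMap k A (a ^ q) * y + algebraMap k A b) ^ q +
      (x + algebraMap k A (a ^ q) * y + algebraMap k A b) = (y + algebraMap k A a) ^ (q + 1) := by
  have := Fact.mk hp
  have : CharP A p := charP_of_injective_algebraMap (algebraMap k A).injective p
  have hf : ∀ u v : A, (u + v) ^ q = u ^ q + v ^ q := by
    intro u v; rw [hq]; exact add_pow_char_pow u v p n
  have ha' : (algebraMap k A a ^ q) ^ q = algebraMap k A a := by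
    rw [← pow_mul, ← sq, ← map_pow, ha]
  have hb' : algebraMap k A b ^ q + algebraMap k A b = algebraMap k A a ^ q * algebraMap k A a := by
    rw [← pow_succ, ← map_pow, ← map_pow, ← map_add, hb]
  rw [pow_succ] at h ⊢
  rw [hf, hf, hf, mul_pow, map_pow, ha']
  linear_combination h + hb'

theorem herm_inv (k : Type) [Field k] (p : ℕ) (hp : p.Prime) [CharP k p] (q n : ℕ)
    (hq : q = p ^ n) (a b : k) (ha : a ^ q ^ 2 = a) (hb : b ^ q + b = a ^ (q + 1)) :
    (-a) ^ q = - a ^ q ∧ (-a) ^ q ^ 2 = -a ∧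
      (a ^ (q + 1) - b) ^ q + (a ^ (q + 1) - b) = (-a) ^ (q + 1) := by
  have := Fact.mk hp
  have hs : ∀ u v : k, (u - v) ^ q = u ^ q - v ^ q := by
    intro u v; rw [hq]; exact sub_pow_char_pow u v n
  have hq0 : q ≠ 0 := by rw [hq]; exact pow_ne_zero _ hp.ne_zero
  have hn : ∀ u : k, (-u) ^ q = - u ^ q := by
    intro u; have := hs 0 u; rwa [zero_pow hq0, zero_sub, zero_sub] at this
  have ha' : (a ^ q) ^ q = a := by rw [← pow_mul, ← sq, ha]
  refine ⟨hn a, ?_, ?_⟩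
  · rw [sq, pow_mul, hn, hn, ha']
  · rw [hs, pow_succ, pow_succ, hn, mul_pow, ha']
    rw [pow_succ] at hb
    linear_combination -hb

noncomputable def hermEnd (k : Type) [Field k] (p : ℕ) (hp : p.Prime) [CharP k p] (q n : ℕ)
    (hq : q = p ^ n) [IsDomain (HermitianRing k q)] (a b : k) (ha : a ^ q ^ 2 = a)
    (hb : b ^ q + b = a ^ (q + 1)) : HermitianRing k q →ₐ[k] HermitianRing k q :=
  hermHom k q _ _ (herm_param k p hp q n hq _ _ (herm_eq k q) a b ha hb)

theorem hermEnd_comp (k : Type) [Field k] (p : ℕ) (hp : p.Prime) [CharP k p] (q n : ℕ)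
    (hq : q = p ^ n) [IsDomain (HermitianRing k q)] (a b : k) (ha : a ^ q ^ 2 = a)
    (hb : b ^ q + b = a ^ (q + 1)) (a' b' : k) (ha' : a' ^ q ^ 2 = a')
    (hb' : b' ^ q + b' = a' ^ (q + 1)) (h1 : a' = -a) (h2 : a' ^ q = - a ^ q)
    (h3 : b' + b = a ^ (q + 1)) :
    (hermEnd k p hp q n hq a b ha hb).comp (hermEnd k p hp q n hq a' b' ha' hb') =
      AlgHom.id k _ := by
  have h3' := congrArg (algebraMap k (HermitianRing k q)) (h3.trans (pow_succ a q))
  have h2' := congrArg (algebraMap k (HermitianRing k q)) h2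
  have h1' := congrArg (algebraMap k (HermitianRing k q)) h1
  simp only [map_add, map_mul, map_neg] at h1' h2' h3'
  apply herm_ext
  · simp only [hermEnd, AlgHom.comp_apply, hermHom_X, hermHom_Y, map_add, map_mul, AlgHom.commutes,
      AlgHom.id_apply]
    linear_combination h3' + (Ideal.Quotient.mk _ (MvPolynomial.X 1) + algebraMap k (HermitianRing k q) a) * h2'
  · simp only [hermEnd, AlgHom.comp_apply, hermHom_X, hermHom_Y, map_add, map_mul, AlgHom.commutes,
      AlgHom.id_apply]
    linear_combination h1'

theorem herm_aut (k : Type) [Field k] (p : ℕ) (hp : p.Prime) [CharP k p] (q n : ℕ)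
    (hq : q = p ^ n) [IsDomain (HermitianRing k q)] (a b : k) (ha : a ^ q ^ 2 = a)
    (hb : b ^ q + b = a ^ (q + 1)) :
    ∃ e : HermitianFunctionField k q ≃ₐ[k] HermitianFunctionField k q,
      e (hermitianX k q) = hermitianX k q + algebraMap k _ (a ^ q) * hermitianY k q
        + algebraMap k _ b ∧
      e (hermitianY k q) = hermitianY k q + algebraMap k _ a := by
  obtain ⟨i1, i2, i3⟩ := herm_inv k p hp q n hq a b ha hb
  let e0 : HermitianRing k q ≃ₐ[k] HermitianRing k q := AlgEquiv.ofAlgHom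
    (hermEnd k p hp q n hq a b ha hb) (hermEnd k p hp q n hq (-a) (a ^ (q + 1) - b) i2 i3)
    (hermEnd_comp _ _ _ _ _ _ _ _ _ _ _ _ _ _ rfl i1 (by ring))
    (hermEnd_comp _ _ _ _ _ _ _ _ _ _ _ _ _ _ (by ring) (by rw [i1]; ring)
      (by rw [pow_succ, pow_succ, i1]; ring))
  refine ⟨IsFractionRing.fieldEquivOfAlgEquiv k _ _ e0, ?_, ?_⟩
  · unfold hermitianX
    rw [IsFractionRing.fieldEquivOfAlgEquiv_algebraMap]
    simp only [e0, AlgEquiv.ofAlgHom_apply, hermEnd, hermHom_X, map_add, map_mul]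
    rfl
  · unfold hermitianY
    rw [IsFractionRing.fieldEquivOfAlgEquiv_algebraMap]
    simp only [e0, AlgEquiv.ofAlgHom_apply, hermEnd, hermHom_Y, map_add, map_mul]
    rfl

open Polynomial in
theorem herm_natDeg {F : Type} [Field F] (N : ℕ) (r : F[X]) (h : r.degree < N) :
    (X ^ N + r).natDegree = N := by
  apply natDegree_eq_of_degree_eq_some
  rw [degree_add_eq_left_of_degree_lt (by rwa [degree_X_pow]), degree_X_pow]

open Polynomial in
theorem herm_natDeg' {F : Type} [Field F] (N : ℕ) (r : F[X]) (h : r.degree < N) :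
    (X ^ N - r).natDegree = N := by
  rw [sub_eq_add_neg]; exact herm_natDeg _ _ (by rwa [degree_neg])

open Polynomial in
theorem herm_count (k : Type) [Field k] [IsAlgClosed k] (N : ℕ) (hN : 2 ≤ N) (h0 : (N : k) = 0)
    (c d : k) (hc : c ≠ 0) :
    Nat.card {a : k // a ^ N + c * a = d} = N := by
  let P : k[X] := X ^ N + (C c * X - C d)
  have hd : P.natDegree = N := by
    apply herm_natDeg
    rw [sub_eq_add_neg, ← C_neg]
    exact degree_linear_lt.trans_le (by exact_mod_cast hN)
  have hder : derivative P = C c := by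
    simp [P, derivative_X_pow, h0]
  have hsep : P.Separable := by
    rw [separable_def, hder]
    exact ⟨0, C c⁻¹, by rw [zero_mul, zero_add, ← C_mul, inv_mul_cancel₀ hc, C_1]⟩
  have := card_rootSet_eq_natDegree (K := k) hsep (IsAlgClosed.splits _)
  rw [hd, ← Nat.card_eq_fintype_card] at this
  have hP0 : P ≠ 0 := hsep.ne_zero
  refine Eq.trans (Nat.card_congr ?_) this
  apply Equiv.subtypeEquivRight
  intro a
  rw [mem_rootSet]
  simp only [hP0, P, ne_eq, not_false_eq_true, true_and, map_add, map_sub, map_mul, map_pow,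
    aeval_X, aeval_C, Algebra.algebraMap_self, RingHom.id_apply]
  rw [← add_sub_assoc, sub_eq_zero]

open Polynomial in
/-- Let `k` be an algebraically closed field of characteristic `p > 0` and `q ≥ 3` a power
of `p`. The function field `K` of the Hermitian curve `x^q + x = y^(q+1)` is a finite Galois
extension of its subfield `k(y^(q²) − y)`, of degree `q³`. -/
theorem hermitian_galois_extension_y (k : Type) [Field k] [IsAlgClosed k]
    (p : ℕ) (hp : p.Prime) [CharP k p] (q : ℕ) (hq : ∃ n : ℕ, 0 < n ∧ q = p ^ n)
    (hq3 : 3 ≤ q) [IsDomain (HermitianRing k q)] :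
    FiniteDimensional
      (IntermediateField.adjoin k {hermitianY k q ^ q ^ 2 - hermitianY k q})
      (HermitianFunctionField k q) ∧
    IsGalois
      (IntermediateField.adjoin k {hermitianY k q ^ q ^ 2 - hermitianY k q})
      (HermitianFunctionField k q) ∧
    Module.finrank
      (IntermediateField.adjoin k {hermitianY k q ^ q ^ 2 - hermitianY k q})
      (HermitianFunctionField k q) = q ^ 3 := by
  obtain ⟨n, hn, hqn⟩ := hq
  have := Fact.mk hp
  have : CharP (HermitianFunctionField k q) p :=
    charP_of_injective_algebraMap (algebraMap k _).injective p
  have hq2 : q < q ^ 2 := by nlinarith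
  have hk0 : (q : k) = 0 := by rw [hqn, Nat.cast_pow, CharP.cast_eq_zero, zero_pow hn.ne']
  set F := IntermediateField.adjoin k {hermitianY k q ^ q ^ 2 - hermitianY k q} with hF
  let t : F := ⟨_, IntermediateField.mem_adjoin_simple_self k _⟩
  let y' : IntermediateField.adjoin F {hermitianY k q} :=
    ⟨_, IntermediateField.mem_adjoin_simple_self F (hermitianY k q)⟩
  have hdP : (X + C t : F[X]).degree < (q ^ 2 : ℕ) := by
    refine (degree_X_add_C t).trans_lt ?_
    exact_mod_cast (by omega : 1 < q ^ 2)
  have hdQ : (X - C (y' ^ (q + 1))).degree < (q : WithBot ℕ) := by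
    refine (degree_X_sub_C _).trans_lt ?_
    exact_mod_cast (by omega : 1 < q)
  obtain ⟨hfin, hle⟩ := herm_upper (F := F) (hermitianX k q) (hermitianY k q) (q ^ 2) q
    (X ^ q ^ 2 - (X + C t)) (monic_X_pow_sub hdP) (herm_natDeg' _ _ hdP)
    (by 
      simp only [map_sub, map_add, map_pow, aeval_X, aeval_C]
      change _ - (_ + (hermitianY k q ^ q ^ 2 - hermitianY k q)) = _
      ring)
    (X ^ q + (X - C (y' ^ (q + 1)))) (monic_X_pow_add hdQ) (herm_natDeg _ _ hdQ)
    (by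
      simp only [map_sub, map_add, map_pow, aeval_X, aeval_C]
      change _ + (_ - hermitianY k q ^ (q + 1)) = _
      rw [← hermK_eq]; ring)
    (fun S h1 h2 h3 => herm_top k q S (fun c => h1 (algebraMap k F c)) h2 h3)
  let T := Σ a : {a : k // a ^ q ^ 2 + (-1) * a = 0}, {b : k // b ^ q + 1 * b = a.1 ^ (q + 1)}
  have hT : Nat.card T = q ^ 3 := by
    have h1 := herm_count k (q ^ 2) (by omega) (by simp [hk0]) (-1) 0 (by simp)
    have h2 := fun d => herm_count k q (by omega) hk0 1 d one_ne_zero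
    have : Finite {a : k // a ^ q ^ 2 + (-1) * a = 0} := Nat.finite_of_card_ne_zero (by omega)
    have := fun d => (Nat.finite_of_card_ne_zero (by rw [h2 d]; omega) :
      Finite {b : k // b ^ q + 1 * b = d})
    have := Fintype.ofFinite {a : k // a ^ q ^ 2 + (-1) * a = 0}
    rw [Nat.card_sigma]
    simp only [h2]
    rw [Finset.sum_const, Finset.card_univ, ← Nat.card_eq_fintype_card, h1, smul_eq_mul]
    ring
  have hex : ∀ s : T, ∃ e : HermitianFunctionField k q ≃ₐ[F] HermitianFunctionField k q,
      e (hermitianX k q) = hermitianX k q + algebraMap k _ (s.1.1 ^ q) * hermitianY k q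
        + algebraMap k _ s.2.1 ∧
      e (hermitianY k q) = hermitianY k q + algebraMap k _ s.1.1 := by
    rintro ⟨⟨a, ha⟩, ⟨b, hb⟩⟩
    have ha' : a ^ q ^ 2 = a := by linear_combination ha
    obtain ⟨e, hx, hy⟩ := herm_aut k p hp q n hqn a b ha' (by simpa using hb)
    have hmem : e ∈ F.fixingSubgroup := by
      have : F ≤ IntermediateField.fixedField (Subgroup.zpowers e) := by
        rw [hF, IntermediateField.adjoin_simple_le_iff]
        rw [IntermediateField.mem_fixedField_iff]
        intro f hf
        have he : e (hermitianY k q ^ q ^ 2 - hermitianY k q) =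
            hermitianY k q ^ q ^ 2 - hermitianY k q := by
          rw [map_sub, map_pow, hy]
          have : q ^ 2 = p ^ (n * 2) := by rw [hqn, pow_mul]
          rw [this, add_pow_char_pow, ← this, ← map_pow, ha']
          ring
        have : Subgroup.zpowers e ≤ MulAction.stabilizer _
            (hermitianY k q ^ q ^ 2 - hermitianY k q) := by
          rw [Subgroup.zpowers_le]; exact he
        exact this hf
      exact (IntermediateField.le_iff_le _ _).1 this (Subgroup.mem_zpowers e)
    exact ⟨F.fixingSubgroupEquiv ⟨e, hmem⟩, hx, hy⟩
  choose f hfx hfy using hex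
  have hinj : Function.Injective f := by
    intro s s' h
    have h1 := hfx s
    have h2 := hfy s
    rw [h, hfx] at h1
    rw [h, hfy] at h2
    obtain ⟨⟨a, ha⟩, ⟨b, hb⟩⟩ := s
    obtain ⟨⟨a', ha'⟩, ⟨b', hb'⟩⟩ := s'
    simp only at h1 h2
    have e1 : a' = a := (algebraMap k (HermitianFunctionField k q)).injective (add_left_cancel h2)
    subst e1
    have e2 : b' = b := (algebraMap k (HermitianFunctionField k q)).injective (add_left_cancel h1)
    subst e2
    rfl
  have hcard := Nat.card_le_card_of_injective f hinj
  rw [hT] at hcard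
  have hub : Nat.card (HermitianFunctionField k q ≃ₐ[F] HermitianFunctionField k q) ≤
      Module.finrank F (HermitianFunctionField k q) := by
    rw [Nat.card_eq_fintype_card]; exact AlgEquiv.card_le
  have hle' : Module.finrank F (HermitianFunctionField k q) ≤ q ^ 3 := hle.trans (le_of_eq (by ring))
  exact ⟨hfin, IsGalois.of_card_aut_eq_finrank _ _ (by omega), by omega⟩
end

section
/- Let k be an algebraically closed field of characteristic p > 0 and q ≥ 3 a power of p. Let K = Frac(k[X, Y]/(X^q + X − Y^{q+1})) be the function field of the Hermitian curve, with x, y ∈ K the images of X, Y. Then K is a finite Galois extension of its subfield k((y/x)^{q²} − (y/x)) (the subfield generated over k by the element (y/x)^{q²} − (y/x)), and [K : k((y/x)^{q²} − (y/x))] = q³. -/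
set_option synthInstance.maxHeartbeats 1000000
set_option maxHeartbeats 2000000

open Polynomial in
lemma aux_deg {k : Type} [Field k] {n : ℕ} {f : k[X]} (h : f.degree < (n : ℕ)) :
    (X ^ n + f).degree = (n : WithBot ℕ) := by
  rw [degree_add_eq_left_of_degree_lt (by rwa [degree_X_pow]), degree_X_pow]

lemma ar1 {K : Type} [Field K] (x a b : K) (hx : x ≠ 0) (N M : ℕ) :
    (a * x⁻¹ ^ M + b * x⁻¹ ^ N) * x ^ (N + M) = a * x ^ N + b * x ^ M := by
  have h : ∀ n : ℕ, x⁻¹ ^ n * x ^ n = 1 := fun n => by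
    rw [← mul_pow, inv_mul_cancel₀ hx, one_pow]
  rw [pow_add]
  linear_combination a * x ^ N * h M + b * x ^ M * h N
lemma ar2 {K : Type} [Field K] (x a : K) (hx : x ≠ 0) (N : ℕ) :
    a * x ^ N = a * x⁻¹ * x ^ (N + 1) := by
  rw [pow_succ]; field_simp
lemma ar3 {K : Type} [Field K] (x a y : K) (hx : x ≠ 0) (N : ℕ) :
    a * x ^ N * y = a * (y / x) * x ^ (N + 1) := by
  rw [pow_succ]; field_simp
lemma ar5 {K : Type} [Field K] (x y : K) (hx : x ≠ 0) (q : ℕ) (h : x ^ q + x = y ^ (q + 1)) :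
    x⁻¹ ^ q + x⁻¹ = (y / x) ^ (q + 1) := by
  rw [div_pow, ← h, inv_pow, pow_succ]
  field_simp
  ring

open Polynomial in
lemma aux_card {k : Type} [Field k] [IsAlgClosed k] [DecidableEq k] (n : ℕ) (hn : 2 ≤ n) (h0 : (n : k) = 0)
    (a d : k) (ha : a ≠ 0) :
    ∃ s : Finset k, s.card = n ∧ ∀ z ∈ s, z ^ n + a * z = d := by
  set P : k[X] := X ^ n + (C a * X + C (-d)) with hP
  have hlt : (C a * X + C (-d) : k[X]).degree < (n : ℕ) :=
    lt_of_le_of_lt degree_linear_le (by exact_mod_cast hn)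
  have hdeg : P.natDegree = n := natDegree_eq_of_degree_eq_some (aux_deg hlt)
  have hP0 : P ≠ 0 := (monic_X_pow_add hlt).ne_zero
  have hsep : P.Separable := by
    rw [Polynomial.separable_def]
    have : derivative P = C a := by simp [hP, h0, derivative_X_pow]
    rw [this]
    exact isCoprime_one_right.of_isCoprime_of_dvd_right
      ⟨C a⁻¹, by rw [← C_mul, mul_inv_cancel₀ ha, C_1]⟩
  refine ⟨P.roots.toFinset, ?_, ?_⟩
  · rw [Multiset.toFinset_card_of_nodup (nodup_roots hsep), ← hdeg]
    exact (splits_iff_card_roots.1 (IsAlgClosed.splits P))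
  · intro z hz
    rw [Multiset.mem_toFinset, mem_roots hP0, IsRoot.def] at hz
    simp [hP] at hz
    linear_combination hz

open Polynomial IntermediateField in
lemma aux_fin {F K : Type} [Field F] [Field K] [Algebra F K] (n : ℕ) (hn : 2 ≤ n) (z : K) (a d : F)
    (h : z ^ n + algebraMap F K a * z = algebraMap F K d) :
    FiniteDimensional F F⟮z⟯ ∧ Module.finrank F F⟮z⟯ ≤ n := by
  set P : F[X] := X ^ n + (C a * X + C (-d)) with hP
  have hlt : (C a * X + C (-d) : F[X]).degree < (n : ℕ) :=
    lt_of_le_of_lt degree_linear_le (by exact_mod_cast hn)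
  have hdeg : P.natDegree = n := natDegree_eq_of_degree_eq_some (aux_deg hlt)
  have hm : P.Monic := monic_X_pow_add hlt
  have hz : aeval z P = 0 := by
    simp [hP]
    linear_combination h
  have hi : IsIntegral F z := ⟨P, hm, hz⟩
  refine ⟨adjoin.finiteDimensional hi, ?_⟩
  rw [adjoin.finrank hi, ← hdeg]
  exact natDegree_le_of_dvd (minpoly.dvd _ _ hz) hm.ne_zero

open IntermediateField in
lemma aux_main {k K : Type} [Field k] [IsAlgClosed k] [Field K] [Algebra k K]
    (p : ℕ) (hp : p.Prime) [CharP k p] (q : ℕ) (hq : ∃ n : ℕ, 0 < n ∧ q = p ^ n)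
    (hq3 : 3 ≤ q) (u w : K) (huw : w ^ q + w = u ^ (q + 1)) (htop : adjoin k {u, w} = ⊤)
    (haut : ∀ b c : k, b ^ q ^ 2 = b → c ^ q + c = b ^ (q + 1) → ∃ σ : K →ₐ[k] K,
      σ u = u + algebraMap k K b ∧ σ w = w + algebraMap k K b ^ q * u + algebraMap k K c) :
    FiniteDimensional (adjoin k {u ^ q ^ 2 - u}) K ∧ IsGalois (adjoin k {u ^ q ^ 2 - u}) K ∧
      Module.finrank (adjoin k {u ^ q ^ 2 - u}) K = q ^ 3 := by
  classical
  obtain ⟨n, hn, hqn⟩ := hq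
  have : Fact p.Prime := ⟨hp⟩
  have : CharP K p := charP_of_injective_algebraMap (algebraMap k K).injective p
  have : ExpChar K p := ExpChar.prime hp
  have hq0 : (q : k) = 0 := by
    rw [hqn]; simp [CharP.cast_eq_zero, hn.ne']
  have hq2 : 2 ≤ q ^ 2 := by nlinarith
  set t := u ^ q ^ 2 - u with ht
  set F := adjoin k {t} with hF
  have htF : t ∈ F := mem_adjoin_simple_self k t
  obtain ⟨f1, r1⟩ := aux_fin (F := F) (q ^ 2) hq2 u (-1) ⟨t, htF⟩ (by
    rw [map_neg, map_one]; change _ = t; rw [ht]; ring)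
  set E := F⟮u⟯ with hE
  have huE : u ∈ E := mem_adjoin_simple_self F u
  obtain ⟨f2, r2⟩ := aux_fin (F := E) q (by omega) w 1 ⟨u ^ (q+1), pow_mem huE _⟩ (by
    rw [map_one]; change _ = u ^ (q+1); rw [← huw]; ring)
  have hEw : E⟮w⟯ = ⊤ := by
    rw [eq_top_iff]
    intro z _
    have hz : z ∈ adjoin k {u, w} := by rw [htop]; trivial
    have : adjoin k {u, w} ≤ (E⟮w⟯.restrictScalars F).restrictScalars k := by
      rw [adjoin_le_iff]
      rintro _ (rfl | rfl)
      · exact E⟮w⟯.algebraMap_mem ⟨_, huE⟩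
      · exact mem_adjoin_simple_self E _
    exact this hz
  rw [hEw] at f2 r2
  have f3 : FiniteDimensional E K := Module.Finite.equiv (topEquiv (F := E) (E := K)).toLinearEquiv
  have r3 : Module.finrank E K ≤ q := by
    rw [finrank_top'] at r2; exact r2
  have f4 : FiniteDimensional F K := FiniteDimensional.trans F E K
  have r4 : Module.finrank F K ≤ q ^ 3 := by
    rw [← Module.finrank_mul_finrank F E K]
    calc _ ≤ q ^ 2 * q := Nat.mul_le_mul r1 r3
      _ = q ^ 3 := by ring
  obtain ⟨S, hS, hSm⟩ := aux_card (k := k) (q ^ 2) hq2 (by push_cast; simp [hq0]) (-1) 0 (by simp)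
  have hT : ∀ b : k, ∃ s : Finset k, s.card = q ∧ ∀ z ∈ s, z ^ q + 1 * z = b ^ (q + 1) := fun b =>
    aux_card (k := k) q (by omega) hq0 1 _ one_ne_zero
  choose T hT hTm using hT
  have hσ : ∀ x : S.sigma T, ∃ σ : K →ₐ[F] K, σ u = u + algebraMap k K x.1.1 ∧
      σ w = w + algebraMap k K x.1.1 ^ q * u + algebraMap k K x.1.2 := by
    rintro ⟨⟨b, c⟩, hx⟩
    rw [Finset.mem_sigma] at hx
    have hb : b ^ q ^ 2 = b := by linear_combination hSm b hx.1
    obtain ⟨σ, h1, h2⟩ := haut b c hb (by linear_combination hTm b c hx.2)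
    have hfix : ∀ z : F, σ z = z := by
      have : F ≤ IntermediateField.mk (AlgHom.equalizer σ (AlgHom.id k K)) (by
          intro z hz
          have hz : σ z = z := hz
          change σ z⁻¹ = z⁻¹
          rw [map_inv₀, hz]) := by
        rw [hF, adjoin_le_iff]
        rintro _ rfl
        change σ t = t
        rw [ht, map_sub, map_pow, h1]
        have : (u + algebraMap k K b) ^ q ^ 2 = u ^ q ^ 2 + algebraMap k K b ^ q ^ 2 := by
          rw [hqn, ← pow_mul, add_pow_expChar_pow]
        rw [this, ← map_pow, hb]; ring
      exact fun z => this z.2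
    exact ⟨{ σ.toRingHom with commutes' := hfix }, h1, h2⟩
  choose σ hσ1 hσ2 using hσ
  have hinj : Function.Injective σ := by
    rintro ⟨⟨b, c⟩, hx⟩ ⟨⟨b', c'⟩, hx'⟩ h
    have e1 := hσ1 ⟨⟨b, c⟩, hx⟩
    have e2 := hσ2 ⟨⟨b, c⟩, hx⟩
    rw [h, hσ1] at e1
    rw [h, hσ2] at e2
    have hb : b' = b := (algebraMap k K).injective (by simpa using e1)
    subst hb
    have hc : c' = c := (algebraMap k K).injective (by simpa using e2)
    subst hc
    rfl
  have hc : q ^ 3 ≤ Nat.card (K →ₐ[F] K) := by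
    have := Nat.card_le_card_of_injective σ hinj
    rw [Nat.card_eq_fintype_card, Fintype.card_coe, Finset.card_sigma] at this
    simp only [hT, Finset.sum_const, hS, smul_eq_mul] at this
    calc q ^ 3 = q ^ 2 * q := by ring
      _ ≤ _ := this
  rw [Nat.card_congr (algEquivEquivAlgHom F K).symm.toEquiv] at hc
  have hle : Nat.card (K ≃ₐ[F] K) ≤ Module.finrank F K := by
    rw [Nat.card_eq_fintype_card]; exact AlgEquiv.card_le
  refine ⟨f4, IsGalois.of_card_aut_eq_finrank F K (by omega), by omega⟩

section
variable {k : Type} [Field k] {q : ℕ}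

noncomputable def hermLift {A : Type} [CommRing A] [Algebra k A] (a b : A)
    (h : a ^ q + a = b ^ (q + 1)) : HermitianRing k q →ₐ[k] A :=
  Ideal.Quotient.liftₐ _ (MvPolynomial.aeval ![a, b]) (by
    intro z hz
    have : Ideal.span {MvPolynomial.X 0 ^ q + MvPolynomial.X 0 - MvPolynomial.X 1 ^ (q + 1)} ≤
      RingHom.ker (MvPolynomial.aeval (R := k) ![a, b]) := by
      rw [Ideal.span_le]
      rintro _ rfl
      simp [RingHom.mem_ker, h]
    exact this hz)

noncomputable def hX (k : Type) [Field k] (q : ℕ) : HermitianRing k q :=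
  Ideal.Quotient.mk _ (MvPolynomial.X 0)
noncomputable def hY (k : Type) [Field k] (q : ℕ) : HermitianRing k q :=
  Ideal.Quotient.mk _ (MvPolynomial.X 1)

lemma hermLift_X {A : Type} [CommRing A] [Algebra k A] (a b : A)
    (h : a ^ q + a = b ^ (q + 1)) : hermLift (k := k) a b h (hX k q) = a := by
  change MvPolynomial.aeval ![a, b] (MvPolynomial.X 0) = a
  simp
lemma hermLift_Y {A : Type} [CommRing A] [Algebra k A] (a b : A)
    (h : a ^ q + a = b ^ (q + 1)) : hermLift (k := k) a b h (hY k q) = b := by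
  change MvPolynomial.aeval ![a, b] (MvPolynomial.X 1) = b
  simp

lemma hXY : hX k q ^ q + hX k q = hY k q ^ (q + 1) := by
  rw [← sub_eq_zero]
  exact Ideal.Quotient.eq_zero_iff_mem.2 (Ideal.subset_span rfl)

lemma herm_ind {P : HermitianRing k q → Prop} (hC : ∀ a : k, P (algebraMap k _ a))
    (ha : ∀ r s, P r → P s → P (r + s)) (hx : ∀ r, P r → P (r * hX k q))
    (hy : ∀ r, P r → P (r * hY k q)) (r) : P r := by
  obtain ⟨f, rfl⟩ := Ideal.Quotient.mk_surjective r
  induction f using MvPolynomial.induction_on with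
  | C a => exact hC a
  | add f g hf hg => rw [map_add]; exact ha _ _ hf hg
  | mul_X f i hf =>
    rw [map_mul]
    fin_cases i
    · exact hx _ hf
    · exact hy _ hf

lemma hX_ne [IsAlgClosed k] (hq : 2 ≤ q) : hX k q ≠ 0 := by
  open Polynomial in
  obtain ⟨z, hz⟩ := IsAlgClosed.exists_root (X ^ q + (C 1 * X + C (-1)) : k[X]) (by
    have hlt : (C 1 * X + C (-1) : k[X]).degree < (q : ℕ) :=
      lt_of_le_of_lt degree_linear_le (by exact_mod_cast hq)
    rw [aux_deg hlt]
    norm_cast; omega)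
  simp at hz
  intro h0
  have := hermLift_X (k := k) (q := q) z 1 (by linear_combination hz)
  rw [h0, map_zero] at this
  rw [← this, zero_pow (by omega)] at hz
  simp at hz

end

lemma herm_tau (k : Type) [Field k] (q : ℕ) [IsDomain (HermitianRing k q)]
    (hx0 : hermitianX k q ≠ 0) (hxy : (hermitianX k q)⁻¹ ^ q + (hermitianX k q)⁻¹ =
      (hermitianY k q / hermitianX k q) ^ (q + 1)) :
    Function.Injective (hermLift (k := k) _ _ hxy) := by
  set ι := algebraMap (HermitianRing k q) (HermitianFunctionField k q) with hι
  have hιi : Function.Injective ι := IsFractionRing.injective _ _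
  set φ := hermLift (k := k) _ _ hxy with hφ
  have φx : φ (hX k q) = (ι (hX k q))⁻¹ := hermLift_X _ _ hxy
  have φy : φ (hY k q) = ι (hY k q) / ι (hX k q) := hermLift_Y _ _ hxy
  replace hx0 : ι (hX k q) ≠ 0 := hx0
  have key : ∀ r, ∃ (N : ℕ) (r' : HermitianRing k q), ι r' = φ r * ι (hX k q) ^ N ∧
      φ r' * ι (hX k q) ^ N = ι r := by
    intro r
    induction r using herm_ind with
    | hC a =>
      refine ⟨0, algebraMap k _ a, ?_, ?_⟩
      · rw [φ.commutes, hι, ← IsScalarTower.algebraMap_apply]; simp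
      · rw [φ.commutes, hι, ← IsScalarTower.algebraMap_apply]; simp
    | ha r s hr hs =>
      obtain ⟨N, r', h1, h2⟩ := hr
      obtain ⟨M, s', h3, h4⟩ := hs
      refine ⟨N + M, r' * hX k q ^ M + s' * hX k q ^ N, ?_, ?_⟩
      · simp only [map_add, map_mul, map_pow, h1, h3]; ring
      · simp only [map_add, map_mul, map_pow, ← h2, ← h4, φx]; exact ar1 _ _ _ hx0 _ _
    | hx r hr =>
      obtain ⟨N, r', h1, h2⟩ := hr
      refine ⟨N + 1, r', ?_, ?_⟩
      · simp only [map_mul, h1, φx]; exact ar2 _ _ hx0 _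
      · simp only [map_mul, ← h2]; ring
    | hy r hr =>
      obtain ⟨N, r', h1, h2⟩ := hr
      refine ⟨N + 1, r' * hY k q, ?_, ?_⟩
      · simp only [map_mul, h1, φy]; exact ar3 _ _ _ hx0 _
      · simp only [map_mul, ← h2, φy]; exact (ar3 _ _ _ hx0 _).symm
  rw [injective_iff_map_eq_zero]
  intro r hr
  obtain ⟨N, r', h1, h2⟩ := key r
  rw [hr, zero_mul] at h1
  have : r' = 0 := hιi (by rw [h1, map_zero])
  rw [this, map_zero, zero_mul] at h2
  exact hιi (by rw [← h2, map_zero])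

lemma herm_sig {k : Type} [Field k] (p : ℕ) (hp : p.Prime) [CharP k p] (q n : ℕ) (hqn : q = p ^ n)
    {A : Type} [CommRing A] [Algebra k A] [CharP A p] (x y : A) (h : x ^ q + x = y ^ (q + 1))
    (b c : k) (hb : b ^ q ^ 2 = b) (hc : c ^ q + c = b ^ (q + 1)) :
    (x + algebraMap k A (b ^ q) * y + algebraMap k A c) ^ q +
      (x + algebraMap k A (b ^ q) * y + algebraMap k A c) = (y + algebraMap k A b) ^ (q + 1) := by
  have : ExpChar A p := ExpChar.prime hp
  have fr : ∀ s t : A, (s + t) ^ q = s ^ q + t ^ q := fun s t => by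
    rw [hqn, add_pow_expChar_pow]
  have hb' : algebraMap k A (b ^ q) ^ q = algebraMap k A b := by
    rw [← map_pow, ← pow_mul, ← sq, hb]
  have hc' : algebraMap k A c ^ q + algebraMap k A c = algebraMap k A (b ^ q) * algebraMap k A b := by
    rw [← map_pow, ← map_add, hc, pow_succ, map_mul]
  rw [pow_succ (y + _), fr, fr, fr, mul_pow, hb', ← map_pow (algebraMap k A) b q]
  rw [pow_succ] at h
  linear_combination h + hc'

/-- Let `k` be an algebraically closed field of characteristic `p > 0` and `q ≥ 3` a power
of `p`. The function field `K` of the Hermitian curve `x^q + x = y^(q+1)` is a finite Galois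
extension of its subfield `k((y/x)^(q²) − (y/x))`, of degree `q³`. -/
theorem hermitian_galois_extension_y_div_x (k : Type) [Field k] [IsAlgClosed k]
    (p : ℕ) (hp : p.Prime) [CharP k p] (q : ℕ) (hq : ∃ n : ℕ, 0 < n ∧ q = p ^ n)
    (hq3 : 3 ≤ q) [IsDomain (HermitianRing k q)] :
    FiniteDimensional
      (IntermediateField.adjoin k
        {(hermitianY k q / hermitianX k q) ^ q ^ 2 - hermitianY k q / hermitianX k q})
      (HermitianFunctionField k q) ∧
    IsGalois
      (IntermediateField.adjoin k
        {(hermitianY k q / hermitianX k q) ^ q ^ 2 - hermitianY k q / hermitianX k q})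
      (HermitianFunctionField k q) ∧
    Module.finrank
      (IntermediateField.adjoin k
        {(hermitianY k q / hermitianX k q) ^ q ^ 2 - hermitianY k q / hermitianX k q})
      (HermitianFunctionField k q) = q ^ 3 := by
  have hιi : Function.Injective (algebraMap (HermitianRing k q) (HermitianFunctionField k q)) :=
    IsFractionRing.injective _ _
  have hx0 : hermitianX k q ≠ 0 := fun h => hX_ne (k := k) (q := q) (by omega)
    (hιi (by rw [map_zero]; exact h))
  have hxy0 : hermitianX k q ^ q + hermitianX k q = hermitianY k q ^ (q + 1) := by
    have := congrArg (algebraMap (HermitianRing k q) (HermitianFunctionField k q)) (hXY (k := k) (q := q))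
    rw [map_add, map_pow, map_pow] at this
    exact this
  have hxy : (hermitianX k q)⁻¹ ^ q + (hermitianX k q)⁻¹ =
      (hermitianY k q / hermitianX k q) ^ (q + 1) := by
    exact ar5 _ _ hx0 _ hxy0
  refine aux_main p hp q hq hq3 _ _ hxy ?_ ?_
  · rw [eq_top_iff]
    intro z _
    set L := IntermediateField.adjoin k
      {hermitianY k q / hermitianX k q, (hermitianX k q)⁻¹} with hL
    have h1 : hermitianY k q / hermitianX k q ∈ L :=
      IntermediateField.subset_adjoin _ _ (by simp)
    have h2 : (hermitianX k q)⁻¹ ∈ L := IntermediateField.subset_adjoin _ _ (by simp)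
    have h3 : hermitianX k q ∈ L := by simpa using L.inv_mem h2
    have h4 : hermitianY k q ∈ L := by
      have := L.mul_mem h1 h3
      rwa [div_mul_cancel₀ _ hx0] at this
    have key : ∀ r, algebraMap (HermitianRing k q) (HermitianFunctionField k q) r ∈ L := by
      intro r
      induction r using herm_ind with
      | hC a => rw [← IsScalarTower.algebraMap_apply]; exact L.algebraMap_mem a
      | ha r s hr hs => rw [map_add]; exact L.add_mem hr hs
      | hx r hr => rw [map_mul]; exact L.mul_mem hr h3
      | hy r hr => rw [map_mul]; exact L.mul_mem hr h4
    obtain ⟨a, b, _, rfl⟩ := IsFractionRing.div_surjective (A := HermitianRing k q) z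
    exact L.div_mem (key a) (key b)
  · intro b c hb hc
    obtain ⟨n, hn, hqn⟩ := hq
    have : CharP (HermitianRing k q) p :=
      charP_of_injective_algebraMap (algebraMap k (HermitianRing k q)).injective p
    have : ExpChar k p := ExpChar.prime hp
    have frs : ∀ s t : k, (s - t) ^ q = s ^ q - t ^ q := fun s t => by
      rw [hqn, sub_pow_expChar_pow]
    have hbq : (b ^ q) ^ q = b := by rw [← pow_mul, ← sq, hb]
    have hneg : (-b) ^ q = -(b ^ q) := by
      have := frs 0 b
      rwa [zero_sub, zero_pow (by omega), zero_sub] at this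
    have hc2 : (b ^ (q + 1) - c) ^ q + (b ^ (q + 1) - c) = (-b) ^ (q + 1) := by
      rw [pow_succ] at hc
      rw [frs, pow_succ, pow_succ, mul_pow, hbq, hneg]
      linear_combination -hc
    have e1 := herm_sig p hp q n hqn (hX k q) (hY k q) hXY b c hb hc
    have e2 := herm_sig p hp q n hqn (hX k q) (hY k q) hXY (-b) (b ^ (q + 1) - c) (by
      rw [sq, pow_mul, hneg, ← zero_sub, frs, hbq, zero_pow (by omega), zero_sub]) hc2
    set s := hermLift (k := k) _ _ e1 with hs
    set s' := hermLift (k := k) _ _ e2 with hs'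
    have sx : s (hX k q) = _ := hermLift_X _ _ e1
    have sy : s (hY k q) = _ := hermLift_Y _ _ e1
    have sx' : s' (hX k q) = _ := hermLift_X _ _ e2
    have sy' : s' (hY k q) = _ := hermLift_Y _ _ e2
    have hss : ∀ r, s' (s r) = r := by
      intro r
      induction r using herm_ind with
      | hC a => rw [s.commutes, s'.commutes]
      | ha r t hr ht => rw [map_add, map_add, hr, ht]
      | hx r hr =>
        rw [map_mul, map_mul, hr, sx]
        simp only [map_add, map_mul, AlgHom.commutes, sx', sy', hneg, map_neg, map_sub, map_pow]
        ring
      | hy r hr =>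
        rw [map_mul, map_mul, hr, sy]
        simp only [map_add, AlgHom.commutes, sy', map_neg]
        ring
    have hsi : Function.Injective s := Function.LeftInverse.injective hss
    have hti := herm_tau k q hx0 hxy
    set τ0 := hermLift (k := k) _ _ hxy
    let τ : HermitianFunctionField k q →ₐ[k] HermitianFunctionField k q :=
      IsFractionRing.liftAlgHom (g := τ0) hti
    have τr : ∀ r, τ (algebraMap _ _ r) = τ0 r := fun r => IsFractionRing.lift_algebraMap hti r
    have τx : τ (hermitianX k q) = _ := (τr (hX k q)).trans (hermLift_X _ _ hxy)
    have τy : τ (hermitianY k q) = _ := (τr (hY k q)).trans (hermLift_Y _ _ hxy)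
    have hgi : Function.Injective (τ0.comp s) := hti.comp hsi
    let g : HermitianFunctionField k q →ₐ[k] HermitianFunctionField k q :=
      IsFractionRing.liftAlgHom (g := τ0.comp s) hgi
    have gr : ∀ r, g (algebraMap _ _ r) = τ0 (s r) := fun r => IsFractionRing.lift_algebraMap hgi r
    have tx : τ0 (hX k q) = (hermitianX k q)⁻¹ := hermLift_X _ _ hxy
    have ty : τ0 (hY k q) = hermitianY k q / hermitianX k q := hermLift_Y _ _ hxy
    have gx : g (hermitianX k q) = _ := gr (hX k q)
    have gy : g (hermitianY k q) = _ := gr (hY k q)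
    have τu : τ (hermitianY k q / hermitianX k q) = hermitianY k q := by
      rw [map_div₀, τx, τy]; field_simp
    have τw : τ (hermitianX k q)⁻¹ = hermitianX k q := by
      rw [map_inv₀, τx, inv_inv]
    refine ⟨g.comp τ, ?_, ?_⟩
    · rw [AlgHom.comp_apply, τu, gy, sy, map_add, AlgHom.commutes, ty]
    · rw [AlgHom.comp_apply, τw, gx, sx, map_add, map_add, map_mul, AlgHom.commutes, AlgHom.commutes,
        tx, ty, map_pow]
end

section
/- Let k be a field of characteristic 2, q₀ ≥ 2 a power of 2, q = 2q₀², and let x, y ∈ k satisfy x^q + x = y^{2q₀}(y^q + y). Set h = x·y + x^{2q₀} + y^{2q₀+2} and assume h ≠ 0. Then the pair (x', y') = (y/h, x/h) again satisfies the Suzuki equation: x'^q + x' = y'^{2q₀}(y'^q + y'). -/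
/-- Let `k` be a field of characteristic 2, `q₀ ≥ 2` a power of 2, `q = 2q₀²`, and let
`(x, y)` satisfy the Suzuki equation `x^q + x = y^(2q₀)(y^q + y)`. With
`h = xy + x^(2q₀) + y^(2q₀+2) ≠ 0`, the pair `(y/h, x/h)` again satisfies the
Suzuki equation. -/
theorem suzuki_involution_preserves_curve (k : Type) [Field k] [CharP k 2]
    (q₀ q : ℕ) (hq₀ : ∃ n : ℕ, q₀ = 2 ^ n) (hq₀2 : 2 ≤ q₀) (hq : q = 2 * q₀ ^ 2)
    (x y : k) (hxy : x ^ q + x = y ^ (2 * q₀) * (y ^ q + y))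
    (h : k) (hh : h = x * y + x ^ (2 * q₀) + y ^ (2 * q₀ + 2)) (hh0 : h ≠ 0) :
    (y / h) ^ q + y / h = (x / h) ^ (2 * q₀) * ((x / h) ^ q + x / h) := by
  obtain ⟨n, rfl⟩ := hq₀
  have two : (2 : k) = 0 := CharTwo.two_eq_zero
  have e1 : 2 * 2 ^ n = 2 ^ (n + 1) := by ring
  have e2 : q = 2 ^ (2 * n + 1) := by rw [hq]; ring
  have F1 : ∀ a b : k, (a + b) ^ (2 * 2 ^ n) = a ^ (2 * 2 ^ n) + b ^ (2 * 2 ^ n) := by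
    intro a b; rw [e1]; exact add_pow_char_pow a b 2 _
  have F2 : ∀ a b : k, (a + b) ^ q = a ^ q + b ^ q := by
    intro a b; rw [e2]; exact add_pow_char_pow a b 2 _
  have F3 : ∀ a : k, (a ^ (2 * 2 ^ n)) ^ (2 * 2 ^ n) = (a ^ q) ^ 2 := by
    intro a; rw [← pow_mul, ← pow_mul, hq]; congr 1; ring
  have F4 : ∀ a : k, (a ^ (2 * 2 ^ n)) ^ q = (a ^ q) ^ (2 * 2 ^ n) := by
    intro a; exact pow_right_comm a _ _
  have hh' : h = x * y + x ^ (2 * 2 ^ n) + y ^ (2 * 2 ^ n) * (y * y) := by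
    rw [hh]; ring
  have hX : x ^ q = x + y ^ (2 * 2 ^ n) * (y ^ q + y) := by
    linear_combination hxy - x * two
  have hXs := congrArg (fun t => t ^ (2 * 2 ^ n)) hX
  have hs := congrArg (fun t => t ^ (2 * 2 ^ n)) hh'
  have hQ := congrArg (fun t => t ^ q) hh'
  simp only [F1, F2, F3, F4, mul_pow] at hXs hs hQ
  have hsne := pow_ne_zero (2 * 2 ^ n) hh0
  have hQne := pow_ne_zero q hh0
  simp only [div_pow]
  rw [hXs] at hQ
  generalize h ^ (2 * 2 ^ n) = S at *
  generalize h ^ q = Q at *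
  generalize (y ^ q) ^ (2 * 2 ^ n) = Z at *
  generalize x ^ (2 * 2 ^ n) = A at *
  generalize y ^ (2 * 2 ^ n) = B at *
  generalize x ^ q = X at *
  generalize y ^ q = Y at *
  clear F1 F2 F3 F4 hh hXs hxy
  have hS : S = A * B + x ^ 2 + B ^ 2 * y ^ 2 := by
    subst hX; rw [hs]; grind
  have hQ2 : Q = x * Y + B * Y * y + A := by
    subst hX; rw [hQ]; grind
  have key : S * (Y * h + y * Q) = A * (X * h + x * Q) := by
    rw [hS, hQ2, hh', hX]; grind
  clear hS hQ2 hQ hs hX hh'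
  field_simp
  linear_combination key
end

section
/- Let k be a field of characteristic 2, q₀ ≥ 2 a power of 2, q = 2q₀², and let x, y ∈ k satisfy x^q + x = y^{2q₀}(y^q + y). Set h = x·y + x^{2q₀} + y^{2q₀+2} and assume h ≠ 0. Then h(y/h, x/h) · h(x, y) = 1, where h(x', y') = x'y' + x'^{2q₀} + y'^{2q₀+2}; consequently the map ψ : (x, y) ↦ (y/h, x/h) satisfies ψ∘ψ = id on points of the Suzuki curve with h ≠ 0. -/
/-- Let `k` be a field of characteristic 2, `q₀ ≥ 2` a power of 2, `q = 2q₀²`, and let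
`(x, y)` satisfy the Suzuki equation `x^q + x = y^(2q₀)(y^q + y)`. With
`h = h(x, y) = xy + x^(2q₀) + y^(2q₀+2) ≠ 0`, one has `h(y/h, x/h) · h(x, y) = 1`;
consequently `ψ : (x, y) ↦ (y/h, x/h)` satisfies `ψ ∘ ψ = id` on such points. -/
theorem suzuki_involution_is_involution (k : Type) [Field k] [CharP k 2]
    (q₀ q : ℕ) (hq₀ : ∃ n : ℕ, q₀ = 2 ^ n) (hq₀2 : 2 ≤ q₀) (hq : q = 2 * q₀ ^ 2)
    (x y : k) (hxy : x ^ q + x = y ^ (2 * q₀) * (y ^ q + y))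
    (h : k) (hh : h = x * y + x ^ (2 * q₀) + y ^ (2 * q₀ + 2)) (hh0 : h ≠ 0) :
    ((y / h) * (x / h) + (y / h) ^ (2 * q₀) + (x / h) ^ (2 * q₀ + 2)) * h = 1 ∧
    (x / h) / ((y / h) * (x / h) + (y / h) ^ (2 * q₀) + (x / h) ^ (2 * q₀ + 2)) = x ∧
    (y / h) / ((y / h) * (x / h) + (y / h) ^ (2 * q₀) + (x / h) ^ (2 * q₀ + 2)) = y := by
  have h2 : (2 : k) = 0 := by exact_mod_cast CharP.cast_eq_zero k 2
  obtain ⟨n, rfl⟩ := hq₀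
  have e1 : 2 * 2 ^ n = 2 ^ (n + 1) := by ring
  have hXX : (x ^ (2 * 2 ^ n)) ^ (2 * 2 ^ n) = (x ^ q) ^ 2 := by
    rw [← pow_mul, ← pow_mul, hq]; congr 1; ring
  have hYY : (y ^ (2 * 2 ^ n)) ^ (2 * 2 ^ n) = (y ^ q) ^ 2 := by
    rw [← pow_mul, ← pow_mul, hq]; congr 1; ring
  have hH : h ^ (2 * 2 ^ n) = x ^ (2 * 2 ^ n) * y ^ (2 * 2 ^ n) + (x ^ (2 * 2 ^ n)) ^ (2 * 2 ^ n)
      + (y ^ (2 * 2 ^ n)) ^ (2 * 2 ^ n) * (y ^ (2 * 2 ^ n)) ^ 2 := by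
    rw [hh, pow_add y, e1, add_pow_char_pow, add_pow_char_pow, mul_pow, mul_pow, pow_right_comm y 2]
  have hH0 : h ^ (2 * 2 ^ n) ≠ 0 := pow_ne_zero _ hh0
  rw [hXX, hYY] at hH
  rw [pow_add] at hh
  have key : ((y / h) * (x / h) + (y / h) ^ (2 * 2 ^ n) + (x / h) ^ (2 * 2 ^ n + 2)) * h = 1 := by
    rw [pow_add, div_pow, div_pow, div_pow]
    generalize h ^ (2 * 2 ^ n) = H at *
    generalize x ^ (2 * 2 ^ n) = X at *
    generalize y ^ (2 * 2 ^ n) = Y at *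
    generalize x ^ q = a at *
    generalize y ^ q = b at *
    have ha : a = Y * (b + y) - x := by linear_combination hxy
    have hH' : H = X * Y + x ^ 2 + Y ^ 2 * y ^ 2 := by
      rw [hH, ha]
      linear_combination (Y ^ 2 * b ^ 2 + Y ^ 2 * b * y - Y * (b + y) * x) * h2
    have e : x * y * H + Y * h ^ 2 + X * x ^ 2 = h * H := by
      rw [hH', hh]
      linear_combination (Y * x * y * X + x * y * Y ^ 2 * y ^ 2) * h2
    clear hH hH' hh ha
    field_simp
    linear_combination e
  generalize (y / h) * (x / h) + (y / h) ^ (2 * 2 ^ n) + (x / h) ^ (2 * 2 ^ n + 2) = g at *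
  refine ⟨key, ?_, ?_⟩ <;> rw [div_div, mul_comm h g, key, div_one]
end

section
/- Let q₀ ≥ 2 be a power of 2, q = 2q₀², and F_q the finite field with q elements. Define h(α, β) = αβ + α^{2q₀} + β^{2q₀+2} for α, β ∈ F_q. Then for every δ ∈ F_q with δ ≠ 0, one has h(δ^{2q₀+1}, 0)^{q₀−1} = δ^{−1} = h(0, δ)^{q₀−1}. Consequently, for every γ ∈ F_q with γ ≠ 0 there exist at least two distinct pairs (α, β) ∈ F_q × F_q with h(α, β)^{2q₀−2} = γ. -/
/-- Let `q₀ ≥ 2` be a power of 2, `q = 2q₀²`, `F` the field with `q` elements, and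
`h(α, β) = αβ + α^(2q₀) + β^(2q₀+2)`. Then for every nonzero `δ ∈ F` one has
`h(δ^(2q₀+1), 0)^(q₀−1) = δ⁻¹ = h(0, δ)^(q₀−1)`; consequently every nonzero `γ ∈ F`
is of the form `h(α, β)^(2q₀−2)` for at least two distinct pairs `(α, β)`. -/
theorem suzuki_h_values (q₀ q : ℕ) (hq₀ : ∃ n : ℕ, q₀ = 2 ^ n) (hq₀2 : 2 ≤ q₀)
    (hq : q = 2 * q₀ ^ 2) (F : Type) [Field F] [Fintype F] (hF : Fintype.card F = q) :
    (∀ δ : F, δ ≠ 0 →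
      (δ ^ (2 * q₀ + 1) * 0 + (δ ^ (2 * q₀ + 1)) ^ (2 * q₀) + 0 ^ (2 * q₀ + 2)) ^ (q₀ - 1)
          = δ⁻¹ ∧
      ((0 : F) * δ + 0 ^ (2 * q₀) + δ ^ (2 * q₀ + 2)) ^ (q₀ - 1) = δ⁻¹) ∧
    (∀ γ : F, γ ≠ 0 → ∃ P₁ P₂ : F × F, P₁ ≠ P₂ ∧
      (P₁.1 * P₁.2 + P₁.1 ^ (2 * q₀) + P₁.2 ^ (2 * q₀ + 2)) ^ (2 * q₀ - 2) = γ ∧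
      (P₂.1 * P₂.2 + P₂.1 ^ (2 * q₀) + P₂.2 ^ (2 * q₀ + 2)) ^ (2 * q₀ - 2) = γ) := by
  obtain ⟨m, rfl⟩ : ∃ m, q₀ = m + 1 := ⟨q₀ - 1, by omega⟩
  have hpow : ∀ δ : F, δ ≠ 0 → δ ^ (2 * m ^ 2 + 4 * m + 1) = 1 := by
    intro δ hδ
    have h := FiniteField.pow_card_sub_one_eq_one δ hδ
    rw [hF, hq] at h
    have e : 2 * (m + 1) ^ 2 - 1 = 2 * m ^ 2 + 4 * m + 1 := by
      have : 2 * (m + 1) ^ 2 = 2 * m ^ 2 + 4 * m + 1 + 1 := by ring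
      omega
    rwa [e] at h
  have key : ∀ δ : F, δ ≠ 0 →
      (δ ^ (2 * (m + 1) + 1) * 0 + (δ ^ (2 * (m + 1) + 1)) ^ (2 * (m + 1))
        + 0 ^ (2 * (m + 1) + 2)) ^ (m + 1 - 1) = δ⁻¹ ∧
      ((0 : F) * δ + 0 ^ (2 * (m + 1)) + δ ^ (2 * (m + 1) + 2)) ^ (m + 1 - 1) = δ⁻¹ := by
    intro δ hδ
    have h := hpow δ hδ
    have z1 : (0 : F) ^ (2 * (m + 1) + 2) = 0 := zero_pow (by omega)
    have z2 : (0 : F) ^ (2 * (m + 1)) = 0 := zero_pow (by omega)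
    rw [z1, z2, mul_zero, zero_mul, zero_add, zero_add, zero_add, add_zero, Nat.add_sub_cancel]
    constructor
    · apply eq_inv_of_mul_eq_one_left
      rw [← pow_mul, ← pow_mul, ← pow_succ]
      have e : (2 * (m + 1) + 1) * (2 * (m + 1) * m) + 1
          = (2 * m ^ 2 + 4 * m + 1) * (2 * m + 1) := by ring
      rw [e, pow_mul, h, one_pow]
    · apply eq_inv_of_mul_eq_one_left
      rw [← pow_mul, ← pow_succ]
      have e : (2 * (m + 1) + 2) * m + 1 = 2 * m ^ 2 + 4 * m + 1 := by ring
      rw [e, h]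
  refine ⟨key, ?_⟩
  intro γ hγ
  have hsq : (γ ^ ((m + 1) ^ 2)) ^ 2 = γ := by
    have h := FiniteField.pow_card γ
    rw [hF, hq] at h
    rw [← pow_mul, mul_comm, h]
  have hε : γ ^ ((m + 1) ^ 2) ≠ 0 := pow_ne_zero _ hγ
  set ε := γ ^ ((m + 1) ^ 2) with hεd
  obtain ⟨k1, k2⟩ := key ε⁻¹ (inv_ne_zero hε)
  have e : 2 * (m + 1) - 2 = (m + 1 - 1) * 2 := by omega
  refine ⟨(ε⁻¹ ^ (2 * (m + 1) + 1), 0), (0, ε⁻¹), ?_, ?_, ?_⟩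
  · intro h
    exact inv_ne_zero hε (congrArg Prod.snd h).symm
  · rw [e, pow_mul]
    dsimp only
    rw [k1, inv_inv, hsq]
  · rw [e, pow_mul]
    dsimp only
    rw [k2, inv_inv, hsq]
end

section
/- Let k be an algebraically closed field of characteristic 2, q₀ ≥ 2 a power of 2, and q = 2q₀². In the polynomial ring (k(t))[X], where k(t) is the field of rational functions in one variable t over k, the polynomial X^q + X − t^{2q₀}(t^q + t) is irreducible. (Hence the function field of the Suzuki curve has degree q over k(y).) -/
open Polynomial

lemma sz_tele {R : Type*} [CommRing R] [CharP R 2] (y : R) (m : ℕ) :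
    (∑ i ∈ Finset.range m, y ^ 2 ^ i) ^ 2 + ∑ i ∈ Finset.range m, y ^ 2 ^ i = y ^ 2 ^ m + y := by
  have h2 : (2 : R) = 0 := CharTwo.two_eq_zero
  induction m with
  | zero => simp; linear_combination -y * h2
  | succ m ih =>
    rw [Finset.sum_range_succ]
    have : y ^ 2 ^ (m+1) = (y ^ 2 ^ m) ^ 2 := by rw [← pow_mul, pow_succ]
    rw [this]
    linear_combination ih + ((∑ i ∈ Finset.range m, y ^ 2 ^ i) * y ^ 2 ^ m + y ^ 2 ^ m) * h2

lemma sz_poly {k : Type*} [Field k] [IsAlgClosed k] [CharP k 2] (n q : ℕ)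
    (hq : q = 2 * (2 ^ n) ^ 2) (a : k) (ha : a ≠ 0) (w : k[X])
    (hw : w ^ 2 + w = C a * (X ^ (2 * 2 ^ n) * (X ^ q + X))) : False := by
  have h2 : (2 : k[X]) = 0 := CharTwo.two_eq_zero
  obtain ⟨b, hb⟩ := IsAlgClosed.exists_pow_nat_eq a (n := 2 ^ (n+1)) (by positivity)
  set u : k[X] := C b * X ^ (1 + 2 ^ n) with hu
  have hu1 : u ^ 2 ^ (n+1) = C a * X ^ (2 * 2 ^ n + q) := by
    rw [hu, mul_pow, ← C_pow, hb, ← pow_mul, hq]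
    congr 2
    ring
  have ht := sz_tele u (n+1)
  set s := ∑ i ∈ Finset.range (n+1), u ^ 2 ^ i
  have key : (w + s) ^ 2 + (w + s) = C a * X ^ (2 * 2 ^ n + 1) + u := by
    rw [hu1] at ht
    have e1 : (X : k[X]) ^ (2 * 2 ^ n) * (X ^ q + X) = X ^ (2 * 2 ^ n + q) + X ^ (2 * 2 ^ n + 1) := by
      ring
    rw [e1] at hw
    linear_combination hw + ht + (w * s + C a * X ^ (2 * 2 ^ n + q)) * h2
  have hd : (C a * X ^ (2 * 2 ^ n + 1) + u).natDegree = 2 * 2 ^ n + 1 := by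
    rw [natDegree_add_eq_left_of_natDegree_lt, natDegree_C_mul_X_pow _ _ ha]
    rw [natDegree_C_mul_X_pow _ _ ha]
    refine lt_of_le_of_lt (natDegree_C_mul_X_pow_le _ _) ?_
    have : 0 < 2 ^ n := by positivity
    omega
  rw [← key] at hd
  by_cases h0 : (w + s).natDegree = 0
  · have : ((w + s) ^ 2 + (w + s)).natDegree ≤ 0 := by
      refine (natDegree_add_le _ _).trans ?_
      simp [natDegree_pow, h0]
    omega
  · rw [natDegree_add_eq_left_of_natDegree_lt] at hd
    · rw [natDegree_pow] at hd
      omega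
    · rw [natDegree_pow]; omega

lemma sz_rat {k : Type*} [Field k] [IsAlgClosed k] [CharP k 2] (n q : ℕ)
    (hq : q = 2 * (2 ^ n) ^ 2) (a : k) (ha : a ≠ 0) (z : RatFunc k)
    (hz : z ^ 2 + z = algebraMap k (RatFunc k) a *
      (RatFunc.X ^ (2 * 2 ^ n) * (RatFunc.X ^ q + RatFunc.X))) : False := by
  set p : k[X] := C a * (X ^ (2 * 2 ^ n) * (X ^ q + X)) with hp
  have hz' : z ^ 2 + z = algebraMap k[X] (RatFunc k) p := by
    rw [hz, hp]
    simp [RatFunc.algebraMap_X, RatFunc.algebraMap_C, RatFunc.algebraMap_eq_C]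
  have hint : IsIntegral k[X] z := by
    refine ⟨X ^ 2 + X - C p, by monicity!, ?_⟩
    simp [hz']
  obtain ⟨w, rfl⟩ := IsIntegrallyClosed.isIntegral_iff.mp hint
  refine sz_poly n q hq a ha w ?_
  apply IsFractionRing.injective k[X] (RatFunc k)
  rw [map_add, map_pow]
  exact hz'

lemma sz_gal {k K : Type} [Field k] [IsAlgClosed k] [CharP k 2] [Field K] [Algebra k K]
    (m : ℕ) (hm : m ≠ 0) (f : K)
    (H : ∀ a : k, a ≠ 0 → ∀ z : K, z ^ 2 + z ≠ algebraMap k K a * f) :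
    Irreducible (X ^ 2 ^ m + X - C f) := by
  have : CharP K 2 := charP_of_injective_algebraMap (algebraMap k K).injective 2
  set P : K[X] := X ^ 2 ^ m + X - C f with hP
  have h1 : 1 < 2 ^ m := Nat.one_lt_two_pow hm
  have hPm : P.Monic := by
    rw [hP, add_sub_assoc]
    refine monic_X_pow_add ?_
    refine lt_of_le_of_lt (b := (1 : WithBot ℕ)) ?_ (by exact_mod_cast h1)
    rw [degree_X_sub_C]
  have hPd : P.natDegree = 2 ^ m := by
    rw [hP, add_sub_assoc]
    rw [natDegree_add_eq_left_of_natDegree_lt] <;> simp [h1]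
  have hPs : P.Separable := by
    rw [Polynomial.separable_def]
    have : derivative P = 1 := by
      have h0 : derivative (X ^ 2 ^ m : K[X]) = 0 := by
        rw [derivative_X_pow, Nat.cast_pow, Nat.cast_ofNat, CharTwo.two_eq_zero, zero_pow hm]
        simp
      simp [hP, h0]
    rw [this]
    exact isCoprime_one_right
  let L := P.SplittingField
  have : IsGalois K L := IsGalois.of_separable_splitting_field hPs
  have : CharP L 2 := charP_of_injective_algebraMap (algebraMap K L).injective 2
  obtain ⟨x, hx⟩ : ∃ x : L, aeval x P = 0 := by
    have := (SplittingField.splits P).exists_eval_eq_zero (f := P.map (algebraMap K L)) (by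
      rw [degree_map]
      intro h
      have : P.natDegree = 0 := natDegree_eq_of_degree_eq_some h
      omega)
    simpa [aeval_def, eval_map] using this
  have hxP : ∀ y : L, aeval y P = 0 ↔ y ^ 2 ^ m + y = algebraMap K L f := by
    intro y
    simp [hP, sub_eq_zero]
  have hx1 := (hxP x).1 hx
  let F := GaloisField 2 m
  have : Fact (Nat.Prime 2) := ⟨Nat.prime_two⟩
  have : Fintype F := Fintype.ofFinite F
  let : Algebra (ZMod 2) k := ZMod.algebra k 2
  let ι : F →+* k := (IsAlgClosed.lift : F →ₐ[ZMod 2] k).toRingHom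
  have hFc : Fintype.card F = 2 ^ m := by
    rw [← Nat.card_eq_fintype_card]; exact GaloisField.card 2 m hm
  let j : F →+* L := ((algebraMap K L).comp (algebraMap k K)).comp ι
  have hjσ : ∀ (σ : L ≃ₐ[K] L) (c : F), σ (j c) = j c := by
    intro σ c
    exact σ.commutes _
  have hcq : ∀ c : F, c ^ 2 ^ m = c := by
    intro c; rw [← hFc]; exact FiniteField.pow_card c
  -- differences of roots
  have hdiff : ∀ σ : L ≃ₐ[K] L, ∃ c : F, σ x = x + j c := by
    intro σ
    have h3 : (σ x) ^ 2 ^ m + σ x = algebraMap K L f := by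
      rw [← map_pow, ← map_add, hx1, σ.commutes]
    have h4 : (σ x - x) ^ 2 ^ m = σ x - x := by
      rw [sub_pow_char_pow]
      have h2 : (2 : L) = 0 := CharTwo.two_eq_zero
      linear_combination h3 - hx1 - (σ x - x) * h2
    classical
    have hne : (X ^ 2 ^ m - X : L[X]) ≠ 0 := FiniteField.X_pow_card_sub_X_ne_zero L h1
    have hsub : Finset.univ.image j ⊆ (X ^ 2 ^ m - X : L[X]).roots.toFinset := by
      intro y hy
      obtain ⟨c, -, rfl⟩ := Finset.mem_image.1 hy
      rw [Multiset.mem_toFinset, mem_roots hne]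
      simp [← map_pow, hcq]
    have heq := Finset.eq_of_subset_of_card_le hsub (by
      rw [Finset.card_image_of_injective _ j.injective, Finset.card_univ, hFc]
      refine (Multiset.toFinset_card_le _).trans ((card_roots' _).trans ?_)
      rw [FiniteField.X_pow_card_sub_X_natDegree_eq L h1])
    have hmem : σ x - x ∈ Finset.univ.image j := by
      rw [heq, Multiset.mem_toFinset, mem_roots hne]
      simp [h4]
    obtain ⟨c, -, hc⟩ := Finset.mem_image.1 hmem
    exact ⟨c, by rw [hc]; ring⟩
  let V : Submodule (ZMod 2) F := AddSubgroup.toZModSubmodule 2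
    { carrier := {c | ∃ σ : L ≃ₐ[K] L, σ x = x + j c}
      zero_mem' := ⟨1, by simp⟩
      add_mem' := by
        rintro c d ⟨σ, hσ⟩ ⟨τ, hτ⟩
        refine ⟨σ * τ, ?_⟩
        rw [AlgEquiv.mul_apply, hτ, map_add, hσ, hjσ, map_add, add_assoc]
      neg_mem' := by
        rintro c ⟨σ, hσ⟩
        exact ⟨σ, by rw [hσ, CharTwo.neg_eq]⟩ }
  have hV : ∀ c, c ∈ V ↔ ∃ σ : L ≃ₐ[K] L, σ x = x + j c := fun c => Iff.rfl
  have hxi : IsIntegral K x := Algebra.IsIntegral.isIntegral x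
  by_cases hVt : V = ⊤
  · have hdvd : minpoly K x ∣ P := minpoly.dvd K x hx
    have hle : P.natDegree ≤ (minpoly K x).natDegree := by
      have hroot : ∀ c : F, x + j c ∈ (minpoly K x).aroots L := by
        intro c
        obtain ⟨σ, hσ⟩ := (hV c).1 (hVt ▸ Submodule.mem_top)
        rw [mem_aroots]
        refine ⟨minpoly.ne_zero hxi, ?_⟩
        rw [← hσ]
        have := Polynomial.aeval_algHom_apply (σ : L →ₐ[K] L) x (minpoly K x)
        simpa using this
      classical
      have hinj : Function.Injective (fun c : F => x + j c) := fun c d h =>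
        j.injective (add_left_cancel h)
      have : (Finset.univ.image (fun c : F => x + j c)).card ≤ (minpoly K x).natDegree := by
        calc _ ≤ ((minpoly K x).aroots L).toFinset.card := by
                apply Finset.card_le_card
                intro y hy
                obtain ⟨c, -, rfl⟩ := Finset.mem_image.1 hy
                exact Multiset.mem_toFinset.2 (hroot c)
          _ ≤ Multiset.card ((minpoly K x).aroots L) := Multiset.toFinset_card_le _
          _ ≤ _ := (card_roots' _).trans natDegree_map_le
      rw [Finset.card_image_of_injective _ hinj, Finset.card_univ, hFc] at this
      rw [hPd]; exact this
    have := eq_of_monic_of_dvd_of_natDegree_le (minpoly.monic hxi) hPm hdvd hle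
    rw [this]
    exact minpoly.irreducible hxi
  · exfalso
    obtain ⟨φ, hφ0, hφ⟩ := Submodule.exists_le_ker_of_lt_top V (lt_top_iff_ne_top.2 hVt)
    obtain ⟨a, ha⟩ : ∃ a : F, ∀ c, φ c = Algebra.trace (ZMod 2) F (a * c) := by
      have hnd := traceForm_nondegenerate (ZMod 2) F
      refine ⟨(LinearMap.BilinForm.toDual _ hnd).symm φ, fun c => ?_⟩
      have := LinearMap.BilinForm.apply_toDual_symm_apply (hB := hnd) φ c
      rw [← this]; rfl
    have ha0 : a ≠ 0 := by
      rintro rfl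
      exact hφ0 (LinearMap.ext fun c => by simp [ha])
    have hsum : ∀ c ∈ V, ∑ i ∈ Finset.range m, (j a * j c) ^ 2 ^ i = 0 := by
      intro c hc
      have h1 : Algebra.trace (ZMod 2) F (a * c) = 0 := by rw [← ha]; exact hφ hc
      have h2 := FiniteField.algebraMap_trace_eq_sum_pow (ZMod 2) F (a * c)
      rw [h1, map_zero, GaloisField.finrank 2 hm] at h2
      have h3 := congrArg j h2
      simp at h3
      simpa using h3.symm
    set z : L := ∑ i ∈ Finset.range m, (j a * x) ^ 2 ^ i with hz
    have hzf : ∀ σ : L ≃ₐ[K] L, σ z = z := by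
      intro σ
      obtain ⟨c, hc⟩ := hdiff σ
      have h0 := hsum c ⟨σ, hc⟩
      rw [hz, map_sum]
      simp_rw [map_pow, map_mul, hjσ, hc, mul_add, add_pow_char_pow]
      rw [Finset.sum_add_distrib, h0, add_zero]
    obtain ⟨w, hw⟩ := (IsGalois.mem_range_algebraMap_iff_fixed z).2 hzf
    refine H (ι a) (by simpa using ha0) w ?_
    apply (algebraMap K L).injective
    have ht := sz_tele (j a * x) m
    rw [← hz, ← hw, mul_pow, ← map_pow j, hcq] at ht
    rw [map_add, map_pow, ht, map_mul, ← hx1]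
    change _ = j a * _
    ring

theorem suzuki_poly_irreducible (k : Type) [Field k] [IsAlgClosed k] [CharP k 2]
    (q₀ q : ℕ) (hq₀ : ∃ n : ℕ, q₀ = 2 ^ n) (hq₀2 : 2 ≤ q₀) (hq : q = 2 * q₀ ^ 2) :
    Irreducible (X ^ q + X -
      C ((RatFunc.X : RatFunc k) ^ (2 * q₀) * ((RatFunc.X : RatFunc k) ^ q + RatFunc.X))) := by
  obtain ⟨n, rfl⟩ := hq₀
  have hqm : q = 2 ^ (2 * n + 1) := by rw [hq]; ring
  have := sz_gal (k := k) (2 * n + 1) (by omega) 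
    ((RatFunc.X : RatFunc k) ^ (2 * 2 ^ n) * ((RatFunc.X : RatFunc k) ^ q + RatFunc.X))
    (fun a ha z hz => sz_rat n q hq a ha z hz)
  rwa [← hqm] at this
end

section
/- Let k be an algebraically closed field of characteristic 2, q₀ ≥ 2 a power of 2, q = 2q₀². Let K = Frac(k[X, Y]/(X^q + X − Y^{2q₀}(Y^q + Y))) be the function field of the Suzuki curve, with x, y ∈ K the images of X, Y. Then K is a finite Galois extension of its subfield k(y^q + y) (the subfield generated over k by the element y^q + y), and [K : k(y^q + y)] = q². -/
set_option synthInstance.maxHeartbeats 1000000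
set_option maxHeartbeats 2000000

/-- The affine coordinate ring `k[X, Y]/(X^q + X − Y^(2q₀)(Y^q + Y))` of the Suzuki curve,
where `q = 2q₀²`. -/
noncomputable abbrev SuzukiRing (k : Type) [Field k] (q₀ q : ℕ) : Type :=
  MvPolynomial (Fin 2) k ⧸
    (Ideal.span {MvPolynomial.X 0 ^ q + MvPolynomial.X 0 -
        MvPolynomial.X 1 ^ (2 * q₀) * (MvPolynomial.X 1 ^ q + MvPolynomial.X 1)} :
      Ideal (MvPolynomial (Fin 2) k))

/-- The function field `K = Frac(k[X, Y]/(X^q + X − Y^(2q₀)(Y^q + Y)))` of the Suzuki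
curve. -/
noncomputable abbrev SuzukiFunctionField (k : Type) [Field k] (q₀ q : ℕ) : Type :=
  FractionRing (SuzukiRing k q₀ q)

/-- The image `x ∈ K` of `X`. -/
noncomputable def suzukiX (k : Type) [Field k] (q₀ q : ℕ) : SuzukiFunctionField k q₀ q :=
  algebraMap (SuzukiRing k q₀ q) (SuzukiFunctionField k q₀ q)
    (Ideal.Quotient.mk _ (MvPolynomial.X 0))

/-- The image `y ∈ K` of `Y`. -/
noncomputable def suzukiY (k : Type) [Field k] (q₀ q : ℕ) : SuzukiFunctionField k q₀ q :=
  algebraMap (SuzukiRing k q₀ q) (SuzukiFunctionField k q₀ q)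
    (Ideal.Quotient.mk _ (MvPolynomial.X 1))

open Polynomial in
theorem sz_deg {F L : Type*} [Field F] [Field L] [Algebra F L] (q : ℕ) (hq : 2 ≤ q) (y : L) (c : F)
    (h : y ^ q + y = algebraMap F L c) :
    IsIntegral F y ∧ Module.finrank F (IntermediateField.adjoin F {y}) ≤ q := by
  have hd : (X - C c : F[X]).degree < (q : WithBot ℕ) := by
    rw [degree_X_sub_C]; exact_mod_cast hq
  have hm : (X ^ q + (X - C c) : F[X]).Monic := monic_X_pow_add hd
  have he : aeval y (X ^ q + (X - C c) : F[X]) = 0 := by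
    simp [← h]
  have hi : IsIntegral F y := ⟨_, hm, he⟩
  refine ⟨hi, ?_⟩
  rw [IntermediateField.adjoin.finrank hi]
  have h1 := natDegree_le_of_dvd (minpoly.dvd F y he) hm.ne_zero
  have h2 : (X ^ q + (X - C c) : F[X]).natDegree = q := by
    apply natDegree_eq_of_degree_eq_some
    rw [degree_add_eq_left_of_degree_lt]
    · simp
    · simpa using hd
  omega

theorem sz_upper {F L : Type*} [Field F] [Field L] [Algebra F L] (q : ℕ) (hq : 2 ≤ q) (y x : L) (c : F)
    (h : y ^ q + y = algebraMap F L c)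
    (h2 : x ^ q + x ∈ IntermediateField.adjoin F {y})
    (htop : IntermediateField.adjoin (IntermediateField.adjoin F {y}) {x} = ⊤) :
    FiniteDimensional F L ∧ Module.finrank F L ≤ q ^ 2 := by
  obtain ⟨hi, hd⟩ := sz_deg q hq y c h
  obtain ⟨hi', hd'⟩ := sz_deg (F := IntermediateField.adjoin F {y}) q hq x ⟨_, h2⟩ rfl
  have := IntermediateField.adjoin.finiteDimensional hi
  have h3 := IntermediateField.adjoin.finiteDimensional hi'
  rw [htop] at hd' h3
  rw [IntermediateField.finrank_top'] at hd'
  have : FiniteDimensional (IntermediateField.adjoin F {y}) L :=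
    Module.Finite.equiv (IntermediateField.topEquiv (F := IntermediateField.adjoin F {y}) (E := L)).toLinearEquiv
  refine ⟨FiniteDimensional.trans F (IntermediateField.adjoin F {y}) L, ?_⟩
  rw [← Module.finrank_mul_finrank F (IntermediateField.adjoin F {y}) L, pow_two]
  exact Nat.mul_le_mul hd hd'

open Polynomial in
theorem sz_roots (k : Type) [Field k] [IsAlgClosed k] [CharP k 2] (m : ℕ) (hm : m ≠ 0) :
    Nat.card {a : k // a ^ (2 ^ m) = a} = 2 ^ m := by
  have hc : ((2 ^ m : ℕ) : k) = 0 := by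
    rw [CharP.cast_eq_zero_iff k 2]; exact dvd_pow_self _ hm
  have h1 : 1 < 2 ^ m := Nat.one_lt_two_pow hm
  have hs : (X ^ (2 ^ m) - X : k[X]).Separable := galois_poly_separable 2 (2 ^ m) (dvd_pow_self _ hm)
  have h := card_rootSet_eq_natDegree hs (IsAlgClosed.splits ((X ^ (2 ^ m) - X : k[X]).map (algebraMap k k)))
  rw [FiniteField.X_pow_card_sub_X_natDegree_eq k h1, ← Nat.card_eq_fintype_card] at h
  refine Eq.trans ?_ h
  apply Nat.card_congr
  apply Equiv.subtypeEquivRight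
  intro a
  rw [mem_rootSet]
  simp [sub_eq_zero, FiniteField.X_pow_card_sub_X_ne_zero k h1]

section
variable (k : Type) [Field k] (q₀ q : ℕ)

noncomputable def szx : SuzukiRing k q₀ q := Ideal.Quotient.mk _ (MvPolynomial.X 0)
noncomputable def szy : SuzukiRing k q₀ q := Ideal.Quotient.mk _ (MvPolynomial.X 1)

theorem sz_rel : szx k q₀ q ^ q + szx k q₀ q = szy k q₀ q ^ (2 * q₀) * (szy k q₀ q ^ q + szy k q₀ q) := by
  rw [← sub_eq_zero]
  have := Ideal.Quotient.eq_zero_iff_mem.2 (Ideal.mem_span_singleton_self (MvPolynomial.X 0 ^ q + MvPolynomial.X 0 -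
        MvPolynomial.X 1 ^ (2 * q₀) * (MvPolynomial.X 1 ^ q + MvPolynomial.X 1) : MvPolynomial (Fin 2) k))
  simp only [map_sub, map_add, map_mul, map_pow] at this
  exact this

variable {k q₀ q}

theorem sz_ext {A : Type} [CommRing A] [Algebra k A] {f g : SuzukiRing k q₀ q →ₐ[k] A}
    (hx : f (szx k q₀ q) = g (szx k q₀ q)) (hy : f (szy k q₀ q) = g (szy k q₀ q)) : f = g := by
  apply Ideal.Quotient.algHom_ext
  apply MvPolynomial.algHom_ext
  intro i
  fin_cases i
  · exact hx
  · exact hy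

noncomputable def szHom {A : Type} [CommRing A] [Algebra k A] (x y : A)
    (h : x ^ q + x = y ^ (2 * q₀) * (y ^ q + y)) : SuzukiRing k q₀ q →ₐ[k] A :=
  Ideal.Quotient.liftₐ _ (MvPolynomial.aeval ![x, y]) (by
    intro a ha
    have : Ideal.span {MvPolynomial.X 0 ^ q + MvPolynomial.X 0 -
        MvPolynomial.X 1 ^ (2 * q₀) * (MvPolynomial.X 1 ^ q + MvPolynomial.X 1)} ≤
        RingHom.ker (MvPolynomial.aeval (R := k) ![x, y]) := by
      rw [Ideal.span_singleton_le_iff_mem, RingHom.mem_ker]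
      simp [h]
    exact this ha)

theorem szHom_x {A : Type} [CommRing A] [Algebra k A] (x y : A)
    (h : x ^ q + x = y ^ (2 * q₀) * (y ^ q + y)) : szHom (k := k) x y h (szx k q₀ q) = x := by
  have : szHom (k := k) x y h (szx k q₀ q) = MvPolynomial.aeval (R := k) ![x, y] (MvPolynomial.X 0) := rfl
  rw [this]; simp

theorem szHom_y {A : Type} [CommRing A] [Algebra k A] (x y : A)
    (h : x ^ q + x = y ^ (2 * q₀) * (y ^ q + y)) : szHom (k := k) x y h (szy k q₀ q) = y := by
  have : szHom (k := k) x y h (szy k q₀ q) = MvPolynomial.aeval (R := k) ![x, y] (MvPolynomial.X 1) := rfl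
  rw [this]; simp

theorem sz_frob {A : Type} [CommRing A] [CharP A 2] (q m : ℕ) (hq : q = 2 ^ m) (u v : A) :
    (u + v) ^ q = u ^ q + v ^ q := by
  rw [hq]; exact add_pow_char_pow u v 2 m

theorem sz_rel2 {A : Type} [CommRing A] [CharP A 2] (n m : ℕ) (hq₀ : q₀ = 2 ^ n) (hq : q = 2 ^ m) (x y a b : A)
    (ha : a ^ q = a) (hb : b ^ q = b)
    (h : x ^ q + x = y ^ (2 * q₀) * (y ^ q + y)) :
    (x + a ^ (2 * q₀) * y + b) ^ q + (x + a ^ (2 * q₀) * y + b)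
      = (y + a) ^ (2 * q₀) * ((y + a) ^ q + (y + a)) := by
  have e : 2 * q₀ = 2 ^ (n + 1) := by rw [hq₀, pow_succ, mul_comm]
  have h1 : ∀ u v : A, (u + v) ^ q = u ^ q + v ^ q := fun u v => by rw [hq]; exact add_pow_char_pow u v 2 m
  have h2 : ∀ u v : A, (u + v) ^ (2 * q₀) = u ^ (2 * q₀) + v ^ (2 * q₀) := fun u v => by
    rw [e]; exact add_pow_char_pow u v 2 (n+1)
  have h0 : (2 : A) = 0 := by exact_mod_cast CharP.cast_eq_zero A 2
  rw [h1, h1, h1, h2, mul_pow, ← pow_mul, mul_comm (2 * q₀) q, pow_mul a, ha, hb]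
  linear_combination h + (b - a * y ^ (2 * q₀) - a * a ^ (2 * q₀)) * h0


theorem sz_aut [CharP k 2] [IsDomain (SuzukiRing k q₀ q)] (n m : ℕ) (hq₀ : q₀ = 2 ^ n) (hq : q = 2 ^ m)
    (a b : k) (ha : a ^ q = a) (hb : b ^ q = b) :
    ∃ σ : SuzukiRing k q₀ q ≃ₐ[k] SuzukiRing k q₀ q,
      σ (szx k q₀ q) = szx k q₀ q + algebraMap k _ a ^ (2 * q₀) * szy k q₀ q + algebraMap k _ b ∧
      σ (szy k q₀ q) = szy k q₀ q + algebraMap k _ a := by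
  have hch : CharP (SuzukiRing k q₀ q) 2 :=
    charP_of_injective_algebraMap (algebraMap k (SuzukiRing k q₀ q)).injective 2
  have h0 : (2 : SuzukiRing k q₀ q) = 0 := by exact_mod_cast CharP.cast_eq_zero (SuzukiRing k q₀ q) 2
  have ha' : (algebraMap k (SuzukiRing k q₀ q) a) ^ q = algebraMap k _ a := by rw [← map_pow, ha]
  have hb' : (algebraMap k (SuzukiRing k q₀ q) b) ^ q = algebraMap k _ b := by rw [← map_pow, hb]
  set A := algebraMap k (SuzukiRing k q₀ q) a with hA
  set B := algebraMap k (SuzukiRing k q₀ q) b with hB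
  have hc : (B + A ^ (2 * q₀) * A) ^ q = B + A ^ (2 * q₀) * A := by
    have h1 : ∀ u v : SuzukiRing k q₀ q, (u + v) ^ q = u ^ q + v ^ q := sz_frob q m hq
    rw [h1, mul_pow, ← pow_mul, mul_comm (2 * q₀) q, pow_mul A, ha', hb']
  let f := szHom (k := k) _ _ (sz_rel2 n m hq₀ hq _ _ A B ha' hb' (sz_rel k q₀ q))
  let g := szHom (k := k) _ _ (sz_rel2 n m hq₀ hq _ _ A (B + A ^ (2 * q₀) * A) ha' hc (sz_rel k q₀ q))
  have fx : f (szx k q₀ q) = _ := szHom_x _ _ _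
  have fy : f (szy k q₀ q) = _ := szHom_y _ _ _
  have gx : g (szx k q₀ q) = _ := szHom_x _ _ _
  have gy : g (szy k q₀ q) = _ := szHom_y _ _ _
  have fA : f A = A := f.commutes a
  have fB : f B = B := f.commutes b
  have gA : g A = A := g.commutes a
  have gB : g B = B := g.commutes b
  refine ⟨AlgEquiv.ofAlgHom f g ?_ ?_, fx, fy⟩
  · apply sz_ext
    · simp only [AlgHom.comp_apply, AlgHom.id_apply, fx, fy, gx, gy, map_add, map_mul, map_pow, fA, fB]
      linear_combination (A ^ (2 * q₀) * szy k q₀ q + B + A ^ (2 * q₀) * A) * h0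
    · simp only [AlgHom.comp_apply, AlgHom.id_apply, fy, gy, map_add, fA]
      linear_combination A * h0
  · apply sz_ext
    · simp only [AlgHom.comp_apply, AlgHom.id_apply, fx, fy, gx, gy, map_add, map_mul, map_pow, gA, gB]
      linear_combination (A ^ (2 * q₀) * szy k q₀ q + B + A ^ (2 * q₀) * A) * h0
    · simp only [AlgHom.comp_apply, AlgHom.id_apply, fy, gy, map_add, gA]
      linear_combination A * h0

theorem sz_aut2 [CharP k 2] [IsDomain (SuzukiRing k q₀ q)] (n m : ℕ) (hq₀ : q₀ = 2 ^ n) (hq : q = 2 ^ m)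
    (a b : k) (ha : a ^ q = a) (hb : b ^ q = b) :
    ∃ σ : SuzukiFunctionField k q₀ q ≃ₐ[k] SuzukiFunctionField k q₀ q,
      σ (suzukiX k q₀ q) = suzukiX k q₀ q + algebraMap k _ a ^ (2 * q₀) * suzukiY k q₀ q + algebraMap k _ b ∧
      σ (suzukiY k q₀ q) = suzukiY k q₀ q + algebraMap k _ a := by
  obtain ⟨σ, h1, h2⟩ := sz_aut n m hq₀ hq a b ha hb
  refine ⟨IsFractionRing.algEquivOfAlgEquiv σ, ?_, ?_⟩
  · refine (IsFractionRing.algEquivOfAlgEquiv_algebraMap σ (szx k q₀ q)).trans ?_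
    rw [h1, map_add, map_add, map_mul, map_pow, ← IsScalarTower.algebraMap_apply,
      ← IsScalarTower.algebraMap_apply]
    rfl
  · refine (IsFractionRing.algEquivOfAlgEquiv_algebraMap σ (szy k q₀ q)).trans ?_
    rw [h2, map_add, ← IsScalarTower.algebraMap_apply]
    rfl

theorem sz_gen [IsDomain (SuzukiRing k q₀ q)] (E : IntermediateField k (SuzukiFunctionField k q₀ q))
    (hx : suzukiX k q₀ q ∈ E) (hy : suzukiY k q₀ q ∈ E) : E = ⊤ := by
  have key : ∀ r : SuzukiRing k q₀ q, algebraMap _ (SuzukiFunctionField k q₀ q) r ∈ E := by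
    intro r
    obtain ⟨p, rfl⟩ := Ideal.Quotient.mk_surjective r
    induction p using MvPolynomial.induction_on with
    | C a => exact E.algebraMap_mem a
    | add p q hp hq => rw [map_add, map_add]; exact E.add_mem hp hq
    | mul_X p i hp =>
      rw [map_mul, map_mul]
      refine E.mul_mem hp ?_
      fin_cases i
      · exact hx
      · exact hy
  rw [eq_top_iff]
  intro z _
  obtain ⟨a, b, _, rfl⟩ := IsFractionRing.div_surjective (A := SuzukiRing k q₀ q) z
  exact E.div_mem (key a) (key b)

end

theorem sz_lower {k L ι : Type*} [Field k] [Field L] [Algebra k L] (t : L)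
    [FiniteDimensional (IntermediateField.adjoin k {t}) L]
    (f : ι → (L ≃ₐ[k] L)) (hf : Function.Injective f) (ht : ∀ i, f i t = t) :
    Nat.card ι ≤ Nat.card (L ≃ₐ[IntermediateField.adjoin k {t}] L) := by
  rw [← Nat.card_congr (IntermediateField.fixingSubgroupEquiv (IntermediateField.adjoin k {t})).toEquiv]
  have : Finite (IntermediateField.adjoin k {t}).fixingSubgroup :=
    Finite.of_equiv _ (IntermediateField.fixingSubgroupEquiv (IntermediateField.adjoin k {t})).symm.toEquiv
  have hmem : ∀ i, f i ∈ (IntermediateField.adjoin k {t}).fixingSubgroup := by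
    intro i
    rw [IntermediateField.mem_fixingSubgroup_iff]
    intro z hz
    have hle : IntermediateField.adjoin k {t} ≤ IntermediateField.fixedField (Subgroup.zpowers (f i)) := by
      rw [IntermediateField.le_iff_le, Subgroup.zpowers_le, IntermediateField.mem_fixingSubgroup_iff]
      intro z hz
      induction hz using IntermediateField.adjoin_induction with
      | mem x hx => rw [Set.mem_singleton_iff.1 hx]; exact ht i
      | algebraMap x => exact (f i).commutes x
      | add x y _ _ hx hy => rw [map_add, hx, hy]
      | inv x _ hx => rw [map_inv₀, hx]
      | mul x y _ _ hx hy => rw [map_mul, hx, hy]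
    exact hle hz ⟨f i, Subgroup.mem_zpowers _⟩
  exact Nat.card_le_card_of_injective (fun i => (⟨f i, hmem i⟩ : (IntermediateField.adjoin k {t}).fixingSubgroup))
    (fun i j h => hf (congrArg Subtype.val h))

/-- Let `k` be an algebraically closed field of characteristic 2, `q₀ ≥ 2` a power of 2,
`q = 2q₀²`. The function field `K` of the Suzuki curve `x^q + x = y^(2q₀)(y^q + y)` is a
finite Galois extension of its subfield `k(y^q + y)`, of degree `q²`. -/
theorem suzuki_galois_extension (k : Type) [Field k] [IsAlgClosed k] [CharP k 2]
    (q₀ q : ℕ) (hq₀ : ∃ n : ℕ, q₀ = 2 ^ n) (hq₀2 : 2 ≤ q₀) (hq : q = 2 * q₀ ^ 2)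
    [IsDomain (SuzukiRing k q₀ q)] :
    FiniteDimensional
      (IntermediateField.adjoin k {suzukiY k q₀ q ^ q + suzukiY k q₀ q})
      (SuzukiFunctionField k q₀ q) ∧
    IsGalois
      (IntermediateField.adjoin k {suzukiY k q₀ q ^ q + suzukiY k q₀ q})
      (SuzukiFunctionField k q₀ q) ∧
    Module.finrank
      (IntermediateField.adjoin k {suzukiY k q₀ q ^ q + suzukiY k q₀ q})
      (SuzukiFunctionField k q₀ q) = q ^ 2 := by
  obtain ⟨n, hn⟩ := hq₀
  obtain ⟨m, hm0, hm⟩ : ∃ m : ℕ, m ≠ 0 ∧ q = 2 ^ m :=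
    ⟨2 * n + 1, by omega, by rw [hq, hn]; ring⟩
  have hq2 : 2 ≤ q := by nlinarith
  have hch : CharP (SuzukiFunctionField k q₀ q) 2 :=
    charP_of_injective_algebraMap (algebraMap k (SuzukiFunctionField k q₀ q)).injective 2
  have h0 : (2 : SuzukiFunctionField k q₀ q) = 0 := by
    exact_mod_cast CharP.cast_eq_zero (SuzukiFunctionField k q₀ q) 2
  have hrel : suzukiX k q₀ q ^ q + suzukiX k q₀ q =
      suzukiY k q₀ q ^ (2 * q₀) * (suzukiY k q₀ q ^ q + suzukiY k q₀ q) := by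
    have := congrArg (algebraMap (SuzukiRing k q₀ q) (SuzukiFunctionField k q₀ q)) (sz_rel k q₀ q)
    simp only [map_add, map_mul, map_pow] at this
    exact this
  set x := suzukiX k q₀ q with hx
  set y := suzukiY k q₀ q with hy
  have hup : FiniteDimensional (IntermediateField.adjoin k {y ^ q + y}) (SuzukiFunctionField k q₀ q) ∧
      Module.finrank (IntermediateField.adjoin k {y ^ q + y}) (SuzukiFunctionField k q₀ q) ≤ q ^ 2 := by
    have hyE := IntermediateField.mem_adjoin_simple_self (IntermediateField.adjoin k {y ^ q + y}) y
    refine sz_upper q hq2 y x ⟨y ^ q + y, IntermediateField.mem_adjoin_simple_self k _⟩ rfl ?_ ?_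
    · rw [hrel]
      exact mul_mem (pow_mem hyE _) (add_mem (pow_mem hyE _) hyE)
    · set E := IntermediateField.adjoin
        (IntermediateField.adjoin (IntermediateField.adjoin k {y ^ q + y}) {y}) {x} with hE
      have h1 : x ∈ E := IntermediateField.mem_adjoin_simple_self _ x
      have h2 : y ∈ E := E.algebraMap_mem ⟨y, hyE⟩
      have h3 := sz_gen ((E.restrictScalars (IntermediateField.adjoin k {y ^ q + y})).restrictScalars k) h1 h2
      rw [eq_top_iff]
      intro z _
      have : z ∈ ((E.restrictScalars (IntermediateField.adjoin k {y ^ q + y})).restrictScalars k) := by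
        rw [h3]; trivial
      exact this
  obtain ⟨hfd, hle⟩ := hup
  have hlow : q ^ 2 ≤ Nat.card (SuzukiFunctionField k q₀ q ≃ₐ[IntermediateField.adjoin k {y ^ q + y}]
      SuzukiFunctionField k q₀ q) := by
    have hcard := sz_roots k m hm0
    rw [← hm] at hcard
    choose f hfx hfy using fun p : {a : k // a ^ q = a} × {a : k // a ^ q = a} =>
      sz_aut2 n m hn hm p.1.1 p.2.1 p.1.2 p.2.2
    have := sz_lower (y ^ q + y) f ?_ ?_
    · rwa [Nat.card_prod, hcard, ← pow_two] at this
    · intro p p' h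
      have e1 : p.1 = p'.1 := by
        have e := (hfy p).symm.trans ((congrArg (fun s => s y) h).trans (hfy p'))
        exact Subtype.ext ((algebraMap k (SuzukiFunctionField k q₀ q)).injective (add_left_cancel e))
      have e2 : p.2 = p'.2 := by
        have e := (hfx p).symm.trans ((congrArg (fun s => s x) h).trans (hfx p'))
        rw [e1] at e
        exact Subtype.ext ((algebraMap k (SuzukiFunctionField k q₀ q)).injective (add_left_cancel e))
      exact Prod.ext e1 e2
    · intro p
      have h1 : ∀ u v : SuzukiFunctionField k q₀ q, (u + v) ^ q = u ^ q + v ^ q := sz_frob q m hm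
      have ha : (algebraMap k (SuzukiFunctionField k q₀ q) p.1.1) ^ q = algebraMap k _ p.1.1 := by
        rw [← map_pow, p.1.2]
      rw [map_add, map_pow, hy, hfy p, h1, ha]
      linear_combination (algebraMap k (SuzukiFunctionField k q₀ q) p.1.1) * h0
  have hmid : Nat.card (SuzukiFunctionField k q₀ q ≃ₐ[IntermediateField.adjoin k {y ^ q + y}]
      SuzukiFunctionField k q₀ q) ≤
      Module.finrank (IntermediateField.adjoin k {y ^ q + y}) (SuzukiFunctionField k q₀ q) := by
    rw [Nat.card_eq_fintype_card]
    exact AlgEquiv.card_le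
  exact ⟨hfd, IsGalois.of_card_aut_eq_finrank _ _ (by omega), by omega⟩
end

section
/- Let k be a field of characteristic 3, q₀ ≥ 3 a power of 3, q = 3q₀², and let a, b, c ∈ k satisfy a^q = a, b^q = b, c^q = c. If x, y₁, y₂ ∈ k satisfy y₁^q − y₁ = x^{q₀}(x^q − x) and y₂^q − y₂ = x^{q₀}(y₁^q − y₁), then the triple (x', y₁', y₂') = (x + a, y₁ + a^{q₀}x + b, y₂ + a^{2q₀}x − a^{q₀}y₁ + c) satisfies the same two equations: y₁'^q − y₁' = x'^{q₀}(x'^q − x') and y₂'^q − y₂' = x'^{q₀}(y₁'^q − y₁'). -/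
/-- Let `k` be a field of characteristic 3, `q₀ ≥ 3` a power of 3, `q = 3q₀²`, and
`a, b, c ∈ k` with `a^q = a`, `b^q = b`, `c^q = c`. If `(x, y₁, y₂)` satisfies the Ree
equations `y₁^q − y₁ = x^(q₀)(x^q − x)` and `y₂^q − y₂ = x^(q₀)(y₁^q − y₁)`, then so does
`(x + a, y₁ + a^(q₀)x + b, y₂ + a^(2q₀)x − a^(q₀)y₁ + c)`. -/
theorem ree_affine_transformation (k : Type) [Field k] [CharP k 3]
    (q₀ q : ℕ) (hq₀ : ∃ n : ℕ, q₀ = 3 ^ n) (hq₀3 : 3 ≤ q₀) (hq : q = 3 * q₀ ^ 2)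
    (a b c : k) (ha : a ^ q = a) (hb : b ^ q = b) (hc : c ^ q = c)
    (x y₁ y₂ : k) (h1 : y₁ ^ q - y₁ = x ^ q₀ * (x ^ q - x))
    (h2 : y₂ ^ q - y₂ = x ^ q₀ * (y₁ ^ q - y₁)) :
    (y₁ + a ^ q₀ * x + b) ^ q - (y₁ + a ^ q₀ * x + b) =
        (x + a) ^ q₀ * ((x + a) ^ q - (x + a)) ∧
    (y₂ + a ^ (2 * q₀) * x - a ^ q₀ * y₁ + c) ^ q - (y₂ + a ^ (2 * q₀) * x - a ^ q₀ * y₁ + c) =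
        (x + a) ^ q₀ * ((y₁ + a ^ q₀ * x + b) ^ q - (y₁ + a ^ q₀ * x + b)) := by
  obtain ⟨n, rfl⟩ := hq₀
  have : Fact (Nat.Prime 3) := ⟨Nat.prime_three⟩
  have hqp : q = 3 ^ (2 * n + 1) := by rw [hq]; ring
  have addq : ∀ u v : k, (u + v) ^ q = u ^ q + v ^ q := by
    intro u v; rw [hqp]; exact add_pow_char_pow u v _ _
  have subq : ∀ u v : k, (u - v) ^ q = u ^ q - v ^ q := by
    intro u v; rw [hqp]; exact sub_pow_char_pow u v _
  have addq0 : (x + a) ^ 3 ^ n = x ^ 3 ^ n + a ^ 3 ^ n := add_pow_char_pow x a _ _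
  have hA : (a ^ 3 ^ n) ^ q = a ^ 3 ^ n := by rw [← pow_mul, mul_comm, pow_mul, ha]
  have h3 : (3 : k) = 0 := by exact_mod_cast CharP.cast_eq_zero k 3
  have hAA : a ^ (2 * 3 ^ n) = a ^ 3 ^ n * a ^ 3 ^ n := by rw [two_mul, pow_add]
  rw [hAA, addq0]
  simp only [addq, subq, mul_pow, hA, ha, hb, hc]
  generalize a ^ 3 ^ n = A at *
  generalize x ^ 3 ^ n = X at *
  generalize x ^ q = Z at *
  generalize y₁ ^ q = Y at *
  generalize y₂ ^ q = W at *
  constructor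
  · linear_combination h1
  · linear_combination h2 - 2 * A * h1 - A * X * (Z - x) * h3
end

section
/- Let k be an algebraically closed field of characteristic 3, q₀ ≥ 3 a power of 3, and q = 3q₀². In the polynomial ring (k(t))[Y], where k(t) is the field of rational functions in one variable t over k, the polynomial Y^q − Y − t^{q₀}(t^q − t) is irreducible. -/
open Polynomial

theorem poly_aux (k : Type) [Field k] [CharP k 3] (n : ℕ) (hn : 1 ≤ n) (p : k[X]) (β : k)
   (hβ : β ≠ 0) (h : p^3 - p = C β * (X^(3^n) * (X^(3*(3^n)^2) - X))) : False := by
  have : Fact (Nat.Prime 3) := ⟨by norm_num⟩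
  have : ExpChar k 3 := ExpChar.prime (by norm_num)
  have h3 : ∀ m, (p^3).coeff (m*3) = (p.coeff m)^3 := by
    intro m
    rw [← map_frobenius_expand 3 p, coeff_map, coeff_expand_mul (by norm_num)]
    rfl
  have h3' : ∀ m, ¬ 3 ∣ m → (p^3).coeff m = 0 := by
    intro m hm
    rw [← map_frobenius_expand 3 p, coeff_map, coeff_expand (by norm_num), if_neg hm, map_zero]
  have hr : ∀ m, (p^3).coeff m - p.coeff m =
      β * ((if m = 3*(3^n)^2 + 3^n then 1 else 0) - (if m = 3^n+1 then 1 else 0)) := by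
    intro m
    rw [← coeff_sub, h, coeff_C_mul, mul_sub, ← pow_add, ← pow_succ, coeff_sub, coeff_X_pow,
      coeff_X_pow, add_comm (3^n)]
  obtain ⟨N, rfl⟩ : ∃ N, n = N + 1 := ⟨n-1, by omega⟩
  have hpos : 0 < 3^N := by positivity
  have hne : ∀ j, (3*3^(N+1)+1)*3^j ≠ 3^(N+1)+1 := by
    intro j
    have h1 : 0 < 3^j := by positivity
    have h2 : 3*3^(N+1)+1 ≤ (3*3^(N+1)+1)*3^j := Nat.le_mul_of_pos_right _ h1
    have h3 : 0 < 3^(N+1) := by positivity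
    omega
  have hz : ∀ j, j ≤ N → p.coeff ((3*3^(N+1)+1)*3^j) = 0 := by
    intro j
    induction j with
    | zero =>
      intro _
      have := hr (3*3^(N+1)+1)
      rw [h3' _ (by omega), if_neg, if_neg] at this
      · simpa using this
      · rw [pow_succ]; omega
      · intro hh
        have : 3 ∣ 3*3^(N+1)+1 := by
          rw [hh, pow_succ]; exact Dvd.dvd.add (Dvd.intro _ rfl) (Dvd.intro_left _ rfl)
        omega
    | succ j ih =>
      intro hj
      have := hr ((3*3^(N+1)+1)*3^(j+1))
      rw [if_neg, if_neg (hne _), pow_succ 3 j, ← mul_assoc, h3, ih (by omega)] at this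
      · simpa [pow_succ, mul_assoc] using this
      · intro hh
        have h1 : 3*(3^(N+1))^2 + 3^(N+1) = (3*3^(N+1)+1)*3^(N+1) := by ring
        rw [h1] at hh
        have := Nat.eq_of_mul_eq_mul_left (by omega) hh
        have := Nat.pow_right_injective (le_refl 2 |>.trans (by norm_num : 2 ≤ 3)) this
        omega
  have hnz : ∀ j, p.coeff ((3*3^(N+1)+1)*3^(N+1+j)) ≠ 0 := by
    intro j
    induction j with
    | zero =>
      have := hr ((3*3^(N+1)+1)*3^(N+1))
      rw [if_pos (by ring), if_neg (hne _)] at this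
      rw [add_zero]
      intro h0
      rw [h0, pow_succ 3 N, ← mul_assoc, h3, ← pow_succ 3 N, hz N le_rfl] at this
      simp at this
      exact hβ this.symm
    | succ j ih =>
      have := hr ((3*3^(N+1)+1)*3^(N+1+(j+1)))
      intro h0
      rw [h0, if_neg, if_neg (hne _), ← add_assoc, pow_succ 3 (N+1+j), ← mul_assoc, h3] at this
      · simp at this
        exact ih this
      · intro hh
        have h1 : 3*(3^(N+1))^2 + 3^(N+1) = (3*3^(N+1)+1)*3^(N+1) := by ring
        rw [h1] at hh
        have := Nat.eq_of_mul_eq_mul_left (by omega) hh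
        have := Nat.pow_right_injective (le_refl 2 |>.trans (by norm_num : 2 ≤ 3)) this
        omega
  refine hnz p.natDegree (coeff_eq_zero_of_natDegree_lt ?_)
  have h1 : p.natDegree < 3^p.natDegree := Nat.lt_pow_self (by norm_num)
  have h2 : 3^p.natDegree ≤ 3^(N+1+p.natDegree) := Nat.pow_le_pow_right (by norm_num) (by omega)
  have h4 : 3^(N+1+p.natDegree) ≤ (3*3^(N+1)+1)*3^(N+1+p.natDegree) :=
    Nat.le_mul_of_pos_left _ (by omega)
  omega

theorem char_aux (m : ℕ) (hm : m ≠ 0) [Fact (Nat.Prime 3)] (H : AddSubgroup (GaloisField 3 m))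
    (hH : H ≠ ⊤) : ∃ b : GaloisField 3 m, b ≠ 0 ∧
      ∀ a ∈ H, ∑ j ∈ Finset.range m, (b * a) ^ 3 ^ j = 0 := by
  have hlt : AddSubgroup.toZModSubmodule 3 H < ⊤ := by
    rw [lt_top_iff_ne_top]
    intro h
    apply hH
    rw [eq_top_iff]
    intro x _
    have : x ∈ AddSubgroup.toZModSubmodule 3 H := by rw [h]; trivial
    exact this
  obtain ⟨f, hf, hk⟩ := Submodule.exists_le_ker_of_lt_top _ hlt
  have nd := traceForm_nondegenerate (ZMod 3) (GaloisField 3 m)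
  refine ⟨(LinearMap.BilinForm.toDual _ nd).symm f, by simpa using hf, fun a ha => ?_⟩
  have h1 := LinearMap.BilinForm.apply_toDual_symm_apply (hB := nd) (f := f) (v := a)
  rw [show f a = 0 from hk ha, Algebra.traceForm_apply] at h1
  have h2 := FiniteField.algebraMap_trace_eq_sum_pow (ZMod 3) (GaloisField 3 m)
    ((LinearMap.BilinForm.toDual _ nd).symm f * a)
  rw [h1, map_zero, GaloisField.finrank 3 hm, Nat.card_zmod] at h2
  exact h2.symm

theorem gal_aux (K : Type) [Field K] [CharP K 3] [Fact (Nat.Prime 3)] (m : ℕ) (hm : m ≠ 0)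
    (i : GaloisField 3 m →+* K) (f : K)
    (hf : ∀ (b : GaloisField 3 m) (c : K), b ≠ 0 → c^3 - c ≠ i b * f) :
    Irreducible (X ^ (3^m) - X - C f) := by
  set g : K[X] := X ^ (3^m) - X - C f with hg
  have h1m : 1 < 3^m := Nat.one_lt_pow hm (by norm_num)
  have hgd : g.natDegree = 3^m := by
    rw [hg, sub_sub]
    refine natDegree_sub_eq_left_of_natDegree_lt ?_ |>.trans (natDegree_X_pow _)
    rw [natDegree_X_pow, natDegree_X_add_C]; exact h1m
  have hgm : g.Monic := by
    rw [hg, sub_sub]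
    refine monic_X_pow_sub ?_
    rw [degree_X_add_C]
    exact_mod_cast h1m
  have hsep : g.Separable := by
    rw [hg, sub_sub, separable_def]
    have : derivative (X ^ 3^m - (X + C f) : K[X]) = -1 := by
      have h3 : ((3^m : ℕ) : K) = 0 := by
        rw [CharP.cast_eq_zero_iff K 3]; exact dvd_pow_self 3 hm
      rw [derivative_sub, derivative_X_pow, h3]
      simp
    rw [this]
    exact isCoprime_one_right.neg_right
  let L := g.SplittingField
  have : IsGalois K L := IsGalois.of_separable_splitting_field hsep
  have : CharP L 3 := charP_of_injective_algebraMap (algebraMap K L).injective 3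
  have : ExpChar L 3 := ExpChar.prime (by norm_num)
  obtain ⟨y, hy⟩ := (SplittingField.splits g).exists_eval_eq_zero (by
    rw [degree_map, degree_eq_natDegree hgm.ne_zero, hgd]; exact_mod_cast (by omega))
  have hroot : ∀ z : L, eval z (g.map (algebraMap K L)) = 0 ↔ z^(3^m) - z = algebraMap K L f := by
    intro z
    simp [hg, sub_eq_zero]
  have hy' := (hroot y).1 hy
  let ι : GaloisField 3 m →+* L := (algebraMap K L).comp i
  let _ : Fintype (GaloisField 3 m) := Fintype.ofFinite _
  have hcard : Fintype.card (GaloisField 3 m) = 3^m := by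
    rw [← Nat.card_eq_fintype_card, GaloisField.card 3 m hm]
  have hpow : ∀ a : GaloisField 3 m, a^(3^m) = a := by
    intro a; rw [← hcard]; exact FiniteField.pow_card a
  have hσ : ∀ (σ : L ≃ₐ[K] L) a, σ (ι a) = ι a := fun σ a => σ.commutes _
  let H : AddSubgroup (GaloisField 3 m) :=
    { carrier := {a | ∃ σ : L ≃ₐ[K] L, σ y = y + ι a}
      zero_mem' := ⟨1, by simp⟩
      add_mem' := by
        rintro a b ⟨σ, h1⟩ ⟨τ, h2⟩
        refine ⟨σ * τ, ?_⟩
        rw [AlgEquiv.mul_apply, h2, map_add, h1, hσ, map_add]; ring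
      neg_mem' := by
        rintro a ⟨σ, h1⟩
        refine ⟨σ⁻¹, ?_⟩
        apply σ.injective
        rw [← AlgEquiv.mul_apply, mul_inv_cancel, map_add, h1, hσ, map_neg]
        simp }
  have hfix : ∀ z : L, z^(3^m) = z → ∃ a, ι a = z := by
    classical
    intro z hz
    by_contra! hcon
    have hs : (insert z (Finset.univ.image ι)).val ⊆ (X^(3^m) - X : L[X]).roots := by
      intro w hw
      rw [mem_roots (FiniteField.X_pow_card_sub_X_ne_zero L h1m)]
      simp only [Finset.insert_val, Finset.image_val] at hw
      have hw : w = z ∨ ∃ a, ι a = w := by simpa using hw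
      rcases hw with rfl | ⟨a, rfl⟩
      · simp [hz]
      · simp [← map_pow, hpow]
    have := card_le_degree_of_subset_roots hs
    rw [FiniteField.X_pow_card_sub_X_natDegree_eq L h1m, Finset.card_insert_of_notMem (by simpa using hcon),
      Finset.card_image_of_injective _ ι.injective, Finset.card_univ, hcard] at this
    omega
  have hdiff : ∀ σ : L ≃ₐ[K] L, ∃ a ∈ H, σ y = y + ι a := by
    intro σ
    obtain ⟨a, ha⟩ := hfix (σ y - y) (by
      have : σ y ^ (3^m) - σ y = algebraMap K L f := by
        rw [← map_pow, ← map_sub, hy', AlgEquiv.commutes]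
      rw [sub_pow_char_pow]
      linear_combination this - hy')
    have : σ y = y + ι a := by rw [ha]; ring
    exact ⟨a, ⟨σ, this⟩, this⟩
  by_cases hH : H = ⊤
  · have hint : IsIntegral K y := Algebra.IsIntegral.isIntegral y
    have hdvd : minpoly K y ∣ g := minpoly.dvd K y (by rw [← eval_map_algebraMap]; exact hy)
    have hle : 3^m ≤ (minpoly K y).natDegree := by
      classical
      have hs : (Finset.univ.image (fun a => y + ι a)).val ⊆
          ((minpoly K y).map (algebraMap K L)).roots := by
        intro w hw
        have hw : ∃ a, y + ι a = w := by simpa using hw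
        obtain ⟨a, rfl⟩ := hw
        rw [mem_roots ((minpoly.monic hint).map _).ne_zero, IsRoot.def, eval_map_algebraMap]
        obtain ⟨σ, hs⟩ : a ∈ H := by rw [hH]; trivial
        rw [← hs]
        exact (aeval_algHom_apply σ y _).trans (by simp)
      have := card_le_degree_of_subset_roots hs
      rwa [Finset.card_image_of_injective _ (fun a b h => ι.injective (add_left_cancel h)),
        Finset.card_univ, hcard, natDegree_map] at this
    have : minpoly K y = g := (eq_of_monic_of_dvd_of_natDegree_le (minpoly.monic hint) hgm hdvd
      (by rw [hgd]; exact hle)).symm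
    rw [← this]
    exact minpoly.irreducible hint
  · exfalso
    obtain ⟨b, hb, hb2⟩ := char_aux m hm H hH
    let c : L := ∑ j ∈ Finset.range m, (ι b * y)^3^j
    have hc : c ∈ (⊥ : IntermediateField K L) := by
      rw [IsGalois.mem_bot_iff_fixed]
      intro σ
      obtain ⟨a, ha, hσa⟩ := hdiff σ
      have h0 := congrArg ι (hb2 a ha)
      simp only [map_sum, map_pow, map_mul, map_zero] at h0
      simp only [c, map_sum, map_pow, map_mul, hσa, hσ, mul_add, add_pow_char_pow,
        Finset.sum_add_distrib, h0, add_zero]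
    obtain ⟨c0, hc0⟩ := IntermediateField.mem_bot.1 hc
    apply hf b c0 hb
    apply (algebraMap K L).injective
    rw [map_sub, map_pow, hc0, map_mul, ← hy']
    have h3 : c^3 = ∑ j ∈ Finset.range m, (ι b * y)^3^(j+1) := by
      simp only [c, sum_pow_char, ← pow_mul, ← pow_succ]
    have h4 := Finset.sum_range_sub (fun j => (ι b * y)^3^j) m
    rw [Finset.sum_sub_distrib, ← h3] at h4
    change c^3 - c = ι b * _
    rw [show c^3 - c = _ from h4, mul_pow, ← map_pow, hpow]
    ring

theorem ree_poly_irreducible (k : Type) [Field k] [IsAlgClosed k] [CharP k 3]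
    (q₀ q : ℕ) (hq₀ : ∃ n : ℕ, q₀ = 3 ^ n) (hq₀3 : 3 ≤ q₀) (hq : q = 3 * q₀ ^ 2) :
    Irreducible (X ^ q - X -
      C ((RatFunc.X : RatFunc k) ^ q₀ * ((RatFunc.X : RatFunc k) ^ q - RatFunc.X))) := by
  obtain ⟨n, rfl⟩ := hq₀
  subst hq
  have hn : 1 ≤ n := by
    rcases n with _ | n
    · norm_num at hq₀3
    · omega
  have : Fact (Nat.Prime 3) := ⟨by norm_num⟩
  have : CharP (RatFunc k) 3 :=
    charP_of_injective_algebraMap (algebraMap k (RatFunc k)).injective 3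
  let _ : Algebra (ZMod 3) k := ZMod.algebra k 3
  let φ : GaloisField 3 (2*n+1) →ₐ[ZMod 3] k := IsAlgClosed.lift
  have key := gal_aux (RatFunc k) (2*n+1) (by omega)
    ((algebraMap k (RatFunc k)).comp φ.toRingHom)
    ((RatFunc.X : RatFunc k) ^ (3^n) * ((RatFunc.X : RatFunc k) ^ (3 * (3^n)^2) - RatFunc.X)) ?_
  · convert key using 4
    ring
  · intro b c hb h
    have e : ((algebraMap k (RatFunc k)).comp φ.toRingHom) b *
        ((RatFunc.X : RatFunc k) ^ (3^n) * ((RatFunc.X : RatFunc k) ^ (3 * (3^n)^2) - RatFunc.X))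
        = algebraMap k[X] (RatFunc k) (C (φ b) * (X^(3^n) * (X^(3*(3^n)^2) - X))) := by
      simp only [map_mul, map_sub, map_pow, RatFunc.algebraMap_X, RatFunc.algebraMap_C]
      rfl
    rw [e] at h
    set P := C (φ b) * (X^(3^n) * (X^(3*(3^n)^2) - X)) with hP
    have hint : IsIntegral k[X] c := by
      refine ⟨X^3 - (X + C P), monic_X_pow_sub (by rw [degree_X_add_C]; norm_num), ?_⟩
      simp only [eval₂_sub, eval₂_add, eval₂_pow, eval₂_X, eval₂_C]
      rw [← h]; ring
    obtain ⟨p, rfl⟩ := IsIntegrallyClosed.isIntegral_iff.1 hint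
    rw [← map_pow, ← map_sub] at h
    exact poly_aux k n hn p (φ b) (by simpa using hb) (RatFunc.algebraMap_injective k h)
end

section
/- Let k be an algebraically closed field of characteristic 3, q₀ ≥ 3 a power of 3, q = 3q₀². Let K = Frac(k[X, Y₁, Y₂]/(Y₁^q − Y₁ − X^{q₀}(X^q − X), Y₂^q − Y₂ − X^{q₀}(Y₁^q − Y₁))) be the function field of the Ree curve, with x, y₁, y₂ ∈ K the images of X, Y₁, Y₂. Then K is a finite Galois extension of its subfield k(x^q − x) (the subfield generated over k by the element x^q − x), and [K : k(x^q − x)] = q³. -/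
set_option synthInstance.maxHeartbeats 1000000
set_option maxHeartbeats 2000000

/-- The affine coordinate ring
`k[X, Y₁, Y₂]/(Y₁^q − Y₁ − X^(q₀)(X^q − X), Y₂^q − Y₂ − X^(q₀)(Y₁^q − Y₁))` of the Ree
curve, where `q = 3q₀²`. -/
noncomputable abbrev ReeRing (k : Type) [Field k] (q₀ q : ℕ) : Type :=
  MvPolynomial (Fin 3) k ⧸
    (Ideal.span
        {MvPolynomial.X 1 ^ q - MvPolynomial.X 1 -
            MvPolynomial.X 0 ^ q₀ * (MvPolynomial.X 0 ^ q - MvPolynomial.X 0),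
         MvPolynomial.X 2 ^ q - MvPolynomial.X 2 -
            MvPolynomial.X 0 ^ q₀ * (MvPolynomial.X 1 ^ q - MvPolynomial.X 1)} :
      Ideal (MvPolynomial (Fin 3) k))

/-- The function field `K` of the Ree curve, the fraction field of `ReeRing k q₀ q`. -/
noncomputable abbrev ReeFunctionField (k : Type) [Field k] (q₀ q : ℕ) : Type :=
  FractionRing (ReeRing k q₀ q)

/-- The image `x ∈ K` of `X`. -/
noncomputable def reeX (k : Type) [Field k] (q₀ q : ℕ) : ReeFunctionField k q₀ q :=
  algebraMap (ReeRing k q₀ q) (ReeFunctionField k q₀ q)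
    (Ideal.Quotient.mk _ (MvPolynomial.X 0))

/-- The image `y₁ ∈ K` of `Y₁`. -/
noncomputable def reeY₁ (k : Type) [Field k] (q₀ q : ℕ) : ReeFunctionField k q₀ q :=
  algebraMap (ReeRing k q₀ q) (ReeFunctionField k q₀ q)
    (Ideal.Quotient.mk _ (MvPolynomial.X 1))

/-- The image `y₂ ∈ K` of `Y₂`. -/
noncomputable def reeY₂ (k : Type) [Field k] (q₀ q : ℕ) : ReeFunctionField k q₀ q :=
  algebraMap (ReeRing k q₀ q) (ReeFunctionField k q₀ q)
    (Ideal.Quotient.mk _ (MvPolynomial.X 2))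

open IntermediateField Polynomial in
theorem ree_tower_step {F K : Type} [Field F] [Field K] [Algebra F K] (y : K) (c : F) (q m : ℕ)
    (hq : 1 < q) (hy : y ^ q - y = algebraMap F K c)
    (h : FiniteDimensional F⟮y⟯ K ∧ Module.finrank F⟮y⟯ K ≤ m) :
    FiniteDimensional F K ∧ Module.finrank F K ≤ q * m := by
  obtain ⟨h1, h2⟩ := h
  have hdeg : (X ^ q - (X + C c) : F[X]).natDegree = q := by
    rw [natDegree_sub_eq_left_of_natDegree_lt] <;> simp [hq]
  have hmon : (X ^ q - (X + C c) : F[X]).Monic := by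
    apply monic_X_pow_sub
    rw [degree_X_add_C]
    exact_mod_cast hq
  have hroot : aeval y (X ^ q - (X + C c) : F[X]) = 0 := by
    simp [← hy]
  have hint : IsIntegral F y := ⟨_, hmon, hroot⟩
  have hfd : FiniteDimensional F F⟮y⟯ := adjoin.finiteDimensional hint
  refine ⟨FiniteDimensional.trans F F⟮y⟯ K, ?_⟩
  rw [← Module.finrank_mul_finrank F F⟮y⟯ K]
  refine Nat.mul_le_mul ?_ h2
  rw [adjoin.finrank hint]
  exact (natDegree_le_natDegree (minpoly.min F y hmon hroot)).trans hdeg.le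

open IntermediateField in
theorem ree_upper {k R K F : Type} [Field k] [CommRing R] [IsDomain R] [Field K] [Algebra k R]
    [Algebra k K] [Algebra R K] [IsFractionRing R K] [IsScalarTower k R K]
    [Field F] [Algebra F K] [Algebra k F] [IsScalarTower k F K] (x y z : R)
    (hgen : Algebra.adjoin k {x, y, z} = ⊤) (q q₀ : ℕ) (hq : 1 < q) (t : F)
    (hx : algebraMap R K x ^ q - algebraMap R K x = algebraMap F K t)
    (hy : y ^ q - y = x ^ q₀ * (x ^ q - x)) (hz : z ^ q - z = x ^ q₀ * (y ^ q - y)) :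
    FiniteDimensional F K ∧ Module.finrank F K ≤ q * (q * (q * 1)) := by
  set X := algebraMap R K x with hX
  set Y := algebraMap R K y with hY
  set Z := algebraMap R K z with hZ
  have hy' : Y ^ q - Y = X ^ q₀ * (X ^ q - X) := by
    have := congrArg (algebraMap R K) hy
    simpa using this
  have hz' : Z ^ q - Z = X ^ q₀ * (Y ^ q - Y) := by
    have := congrArg (algebraMap R K) hz
    simpa using this
  apply ree_tower_step X t q _ hq hx
  have hXm : X ∈ F⟮X⟯ := mem_adjoin_simple_self F X
  have htm : algebraMap F K t ∈ F⟮X⟯ := F⟮X⟯.algebraMap_mem t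
  apply ree_tower_step Y (⟨X, hXm⟩ ^ q₀ * ⟨_, htm⟩ : F⟮X⟯) q _ hq
  · rw [hy', hx]; rfl
  let E2 := (F⟮X⟯)⟮Y⟯
  have hY2 : Y ∈ E2 := mem_adjoin_simple_self _ Y
  have hX2 : X ∈ E2 := E2.algebraMap_mem ⟨X, hXm⟩
  apply ree_tower_step Z (⟨X, hX2⟩ ^ q₀ * (⟨Y, hY2⟩ ^ q - ⟨Y, hY2⟩) : E2) q _ hq
  · rw [hz']; rfl
  let E3 := E2⟮Z⟯
  have hZ3 : Z ∈ E3 := mem_adjoin_simple_self _ Z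
  have hX3 : X ∈ E3 := E3.algebraMap_mem ⟨X, hX2⟩
  have hY3 : Y ∈ E3 := E3.algebraMap_mem ⟨Y, hY2⟩
  have hF1 (r : F) : algebraMap F K r ∈ F⟮X⟯ := F⟮X⟯.algebraMap_mem r
  have hF2 (r : F) : algebraMap F K r ∈ E2 := E2.algebraMap_mem ⟨_, hF1 r⟩
  have hF3 (r : F) : algebraMap F K r ∈ E3 := E3.algebraMap_mem ⟨_, hF2 r⟩
  have hR (r : R) : algebraMap R K r ∈ E3 := by
    have hr : r ∈ Algebra.adjoin k {x, y, z} := by rw [hgen]; trivial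
    induction hr using Algebra.adjoin_induction with
    | mem w hw =>
      rcases hw with rfl | rfl | rfl
      · exact hX3
      · exact hY3
      · exact hZ3
    | algebraMap c =>
      rw [← IsScalarTower.algebraMap_apply, IsScalarTower.algebraMap_apply k F K]
      exact hF3 _
    | add a b _ _ ha hb => rw [map_add]; exact add_mem ha hb
    | mul a b _ _ ha hb => rw [map_mul]; exact mul_mem ha hb
  have htop : E3 = ⊤ := by
    rw [eq_top_iff]
    rintro w -
    obtain ⟨a, b, -, rfl⟩ := IsFractionRing.div_surjective R w
    exact div_mem (hR a) (hR b)
  change FiniteDimensional E3 K ∧ Module.finrank E3 K ≤ 1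
  rw [htop]
  have h1 : Module.finrank (⊤ : IntermediateField E2 K) K = 1 := IntermediateField.finrank_top
  exact ⟨Module.finite_of_finrank_pos (by rw [h1]; norm_num), h1.le⟩

theorem ree_endo {k R : Type} [Field k] [CharP k 3] [CommRing R] [IsDomain R] [Algebra k R]
    (x y z : R) (hgen : Algebra.adjoin k {x, y, z} = ⊤) (q q₀ n m : ℕ) (hq₀ : q₀ = 3 ^ n)
    (hq : q = 3 ^ m)
    (hy : y ^ q - y = x ^ q₀ * (x ^ q - x)) (hz : z ^ q - z = x ^ q₀ * (y ^ q - y))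
    (hlift : ∀ a b c : R, b ^ q - b = a ^ q₀ * (a ^ q - a) → c ^ q - c = a ^ q₀ * (b ^ q - b) →
      ∃ φ : R →ₐ[k] R, φ x = a ∧ φ y = b ∧ φ z = c)
    (a b c : k) (ha : a ^ q = a) (hb : b ^ q = b) (hc : c ^ q = c) :
    ∃ φ : R →ₐ[k] R, Function.Injective φ ∧ φ x = x + algebraMap k R a ∧
      φ y = y + algebraMap k R (a ^ q₀) * x + algebraMap k R b ∧
      φ z = z + 2 * algebraMap k R (a ^ q₀) * y + algebraMap k R (a ^ q₀) ^ 2 * x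
        + algebraMap k R c := by
  have : Fact (Nat.Prime 3) := ⟨Nat.prime_three⟩
  have : CharP R 3 := charP_of_injective_algebraMap (algebraMap k R).injective 3
  have fr (u v : R) : (u + v) ^ q = u ^ q + v ^ q := by rw [hq]; exact add_pow_char_pow u v 3 m
  have fr₀ (u v : R) : (u + v) ^ q₀ = u ^ q₀ + v ^ q₀ := by
    rw [hq₀]; exact add_pow_char_pow u v 3 n
  have h2 : (2 : R) ^ q = 2 := by
    have := fr 1 1
    simp only [one_pow] at this
    norm_num at this
    exact this
  have key : ∀ a b c : k, a ^ q = a → b ^ q = b → c ^ q = c →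
     ∃ φ : R →ₐ[k] R, φ x = x + algebraMap k R a ∧
      φ y = y + algebraMap k R (a ^ q₀) * x + algebraMap k R b ∧
      φ z = z + 2 * algebraMap k R (a ^ q₀) * y + algebraMap k R (a ^ q₀) ^ 2 * x
        + algebraMap k R c := by
    intro a b c ha hb hc
    have hA : algebraMap k R (a ^ q₀) ^ q = algebraMap k R (a ^ q₀) := by
      rw [← map_pow, ← pow_mul, mul_comm, pow_mul, ha]
    have hA2 : (algebraMap k R (a ^ q₀) ^ 2) ^ q = algebraMap k R (a ^ q₀) ^ 2 := by
      rw [← pow_mul, mul_comm, pow_mul, hA]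
    have ha' : algebraMap k R a ^ q = algebraMap k R a := by rw [← map_pow, ha]
    have hb' : algebraMap k R b ^ q = algebraMap k R b := by rw [← map_pow, hb]
    have hc' : algebraMap k R c ^ q = algebraMap k R c := by rw [← map_pow, hc]
    apply hlift
    · simp only [fr, fr₀, mul_pow, hA, ha', hb']
      rw [map_pow]
      linear_combination hy
    · simp only [fr, fr₀, mul_pow, hA, hA2, ha', hb', hc', h2]
      rw [map_pow]
      linear_combination hz + algebraMap k R a ^ q₀ * hy
  have neg_pow' (u : k) (hu : u ^ q = u) : (-u) ^ q = -u := by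
    rw [Odd.neg_pow _ u, hu]
    rw [hq]; exact Odd.pow (by decide)
  have negq₀ : (-a) ^ q₀ = - a ^ q₀ := by
    apply Odd.neg_pow
    rw [hq₀]; exact Odd.pow (by decide)
  have : CharP k 3 := inferInstance
  have frk (u v : k) : (u + v) ^ q = u ^ q + v ^ q := by rw [hq]; exact add_pow_char_pow u v 3 m
  have h2k : (2 : k) ^ q = 2 := by
    have := frk 1 1
    simp only [one_pow] at this
    norm_num at this
    exact this
  have hAk : (a ^ q₀) ^ q = a ^ q₀ := by rw [← pow_mul, mul_comm, pow_mul, ha]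
  have hA2k : ((a ^ q₀) ^ 2) ^ q = (a ^ q₀) ^ 2 := by rw [← pow_mul, mul_comm, pow_mul, hAk]
  obtain ⟨φ, h1, h2', h3⟩ := key a b c ha hb hc
  obtain ⟨ψ, g1, g2, g3⟩ := key (-a) (-b + a ^ q₀ * a)
    (-c + 2 * a ^ q₀ * b + -((a ^ q₀) ^ 2 * a)) (neg_pow' _ ha)
    (by simp only [frk, mul_pow, hAk, ha, neg_pow' _ hb])
    (by
      have : ((a ^ q₀) ^ 2 * a) ^ q = (a ^ q₀) ^ 2 * a := by rw [mul_pow, hA2k, ha]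
      simp only [frk, neg_pow' _ this, neg_pow' _ hc, mul_pow, h2k, hAk, hb])
  refine ⟨φ, ?_, h1, h2', h3⟩
  have hcomp : ψ.comp φ = AlgHom.id k R := by
    apply AlgHom.ext_of_adjoin_eq_top hgen
    rintro w (rfl | rfl | rfl)
    · simp [h1, g1]
    · simp [h2', g2, g1, negq₀]; ring
    · simp [h3, g3, g2, g1, negq₀, map_ofNat]; ring
  intro u v huv
  have := congrArg ψ huv
  rw [← AlgHom.comp_apply, ← AlgHom.comp_apply, hcomp] at this
  simpa using this

open IntermediateField Polynomial in
theorem ree_main {k R K : Type} [Field k] [IsAlgClosed k] [CharP k 3]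
    [CommRing R] [IsDomain R] [Field K] [Algebra k R]
    [Algebra k K] [Algebra R K] [IsFractionRing R K] [IsScalarTower k R K]
    (x y z : R) (hgen : Algebra.adjoin k {x, y, z} = ⊤) (q q₀ n m : ℕ) (hq₀ : q₀ = 3 ^ n)
    (hq : q = 3 ^ m) (hm : m ≠ 0)
    (hy : y ^ q - y = x ^ q₀ * (x ^ q - x)) (hz : z ^ q - z = x ^ q₀ * (y ^ q - y))
    (hlift : ∀ a b c : R, b ^ q - b = a ^ q₀ * (a ^ q - a) → c ^ q - c = a ^ q₀ * (b ^ q - b) →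
      ∃ φ : R →ₐ[k] R, φ x = a ∧ φ y = b ∧ φ z = c) :
    FiniteDimensional (adjoin k {algebraMap R K x ^ q - algebraMap R K x}) K ∧
    IsGalois (adjoin k {algebraMap R K x ^ q - algebraMap R K x}) K ∧
    Module.finrank (adjoin k {algebraMap R K x ^ q - algebraMap R K x}) K = q ^ 3 := by
  have hq1 : 1 < q := by rw [hq]; exact Nat.one_lt_pow hm (by norm_num)
  let F := adjoin k {algebraMap R K x ^ q - algebraMap R K x}
  have htF : algebraMap R K x ^ q - algebraMap R K x ∈ F := mem_adjoin_simple_self _ _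
  obtain ⟨hfd, hle⟩ := ree_upper (K := K) (F := F) x y z hgen q q₀ hq1 ⟨_, htF⟩ rfl hy hz
  have hinj : Function.Injective (algebraMap R K) := IsFractionRing.injective R K
  let S := ((X ^ q - X : k[X])).rootSet k
  have hS : Fintype.card S = q := by
    have hsep : (X ^ q - X : k[X]).Separable :=
      galois_poly_separable 3 q (by rw [hq]; exact dvd_pow_self 3 hm)
    rw [card_rootSet_eq_natDegree hsep (IsAlgClosed.splits _)]
    exact FiniteField.X_pow_card_sub_X_natDegree_eq k hq1
  have hmem (s : S) : (s : k) ^ q = s := by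
    have := aeval_eq_zero_of_mem_rootSet s.2
    simpa [sub_eq_zero] using this
  have hex (s : S × S × S) : ∃ σ : K →ₐ[F] K,
      σ (algebraMap R K x) = algebraMap R K (x + algebraMap k R s.1) ∧
      σ (algebraMap R K y) = algebraMap R K
        (y + algebraMap k R ((s.1 : k) ^ q₀) * x + algebraMap k R s.2.1) ∧
      σ (algebraMap R K z) = algebraMap R K
        (z + 2 * algebraMap k R ((s.1 : k) ^ q₀) * y + algebraMap k R ((s.1 : k) ^ q₀) ^ 2 * x
        + algebraMap k R s.2.2) := by
    obtain ⟨φ, hφ, h1, h2, h3⟩ := ree_endo x y z hgen q q₀ n m hq₀ hq hy hz hlift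
      s.1 s.2.1 s.2.2 (hmem _) (hmem _) (hmem _)
    let g : R →ₐ[k] K := (IsScalarTower.toAlgHom k R K).comp φ
    have hg : Function.Injective g := hinj.comp hφ
    let σ : K →ₐ[k] K := IsFractionRing.liftAlgHom hg
    have hσ (r : R) : σ (algebraMap R K r) = algebraMap R K (φ r) :=
      IsFractionRing.lift_algebraMap hg r
    have : CharP R 3 := charP_of_injective_algebraMap (algebraMap k R).injective 3
    have : Fact (Nat.Prime 3) := ⟨Nat.prime_three⟩
    have ht : σ (algebraMap R K x ^ q - algebraMap R K x)
        = algebraMap R K x ^ q - algebraMap R K x := by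
      have : φ (x ^ q - x) = x ^ q - x := by
        rw [map_sub, map_pow, h1]
        have : (x + algebraMap k R s.1) ^ q = x ^ q + algebraMap k R s.1 := by
          conv_rhs => rw [← hmem s.1, map_pow]
          rw [hq]; exact add_pow_char_pow _ _ 3 m
        rw [this]; ring
      rw [← map_pow, ← map_sub, hσ, this]
    have hcomm (w : K) (hw : w ∈ F) : σ w = w := by
      induction hw using adjoin_induction with
      | mem w hw => rw [Set.mem_singleton_iff.1 hw]; exact ht
      | algebraMap c => exact σ.commutes c
      | add a b _ _ ha hb => rw [map_add, ha, hb]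
      | inv a _ ha => rw [map_inv₀, ha]
      | mul a b _ _ ha hb => rw [map_mul, ha, hb]
    refine ⟨{ σ.toRingHom with commutes' := fun r => hcomm _ r.2 }, ?_, ?_, ?_⟩
    · rw [← h1]; exact hσ x
    · rw [← h2]; exact hσ y
    · rw [← h3]; exact hσ z
  choose Φ hΦ1 hΦ2 hΦ3 using hex
  have hΦ : Function.Injective Φ := by
    rintro ⟨a, b, c⟩ ⟨a', b', c'⟩ h
    have hk : Function.Injective (algebraMap k R) := (algebraMap k R).injective
    have e1 := hΦ1 (a, b, c)
    have e2 := hΦ2 (a, b, c)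
    have e3 := hΦ3 (a, b, c)
    rw [h] at e1 e2 e3
    rw [hΦ1] at e1; rw [hΦ2] at e2; rw [hΦ3] at e3
    have e1 := hk (add_left_cancel (hinj e1))
    have e1 : a' = a := Subtype.ext e1
    subst e1
    have e2 := Subtype.ext (hk (add_left_cancel (hinj e2)))
    have e3 := Subtype.ext (hk (add_left_cancel (hinj e3)))
    dsimp only at e2 e3
    rw [e2, e3]
  have hcard : q ^ 3 ≤ Nat.card (K →ₐ[F] K) := by
    have := Nat.card_le_card_of_injective Φ hΦ
    rw [Nat.card_prod, Nat.card_prod, Nat.card_eq_fintype_card, hS] at this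
    calc q ^ 3 = q * (q * q) := by ring
      _ ≤ _ := this
  have hub : Nat.card (K →ₐ[F] K) ≤ Module.finrank F K := by
    rw [Nat.card_eq_fintype_card]; exact AlgHom.card_le
  have hle' : Module.finrank F K ≤ q ^ 3 := hle.trans (by ring_nf; exact le_rfl)
  have hfin : Module.finrank F K = q ^ 3 := by omega
  refine ⟨hfd, ?_, hfin⟩
  apply IsGalois.of_card_aut_eq_finrank
  rw [Nat.card_congr (algEquivEquivAlgHom F K).toEquiv]
  change Nat.card (K →ₐ[F] K) = Module.finrank F K
  omega

/-- Let `k` be an algebraically closed field of characteristic 3, `q₀ ≥ 3` a power of 3,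
`q = 3q₀²`. The function field `K` of the Ree curve `y₁^q − y₁ = x^(q₀)(x^q − x)`,
`y₂^q − y₂ = x^(q₀)(y₁^q − y₁)` is a finite Galois extension of its subfield `k(x^q − x)`,
of degree `q³`. -/
theorem ree_galois_extension (k : Type) [Field k] [IsAlgClosed k] [CharP k 3]
    (q₀ q : ℕ) (hq₀ : ∃ n : ℕ, q₀ = 3 ^ n) (hq₀3 : 3 ≤ q₀) (hq : q = 3 * q₀ ^ 2)
    [IsDomain (ReeRing k q₀ q)] :
    FiniteDimensional
      (IntermediateField.adjoin k {reeX k q₀ q ^ q - reeX k q₀ q})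
      (ReeFunctionField k q₀ q) ∧
    IsGalois
      (IntermediateField.adjoin k {reeX k q₀ q ^ q - reeX k q₀ q})
      (ReeFunctionField k q₀ q) ∧
    Module.finrank
      (IntermediateField.adjoin k {reeX k q₀ q ^ q - reeX k q₀ q})
      (ReeFunctionField k q₀ q) = q ^ 3 := by
  obtain ⟨n, hn⟩ := hq₀
  have hqm : q = 3 ^ (2 * n + 1) := by rw [hq, hn]; ring
  have hy : (Ideal.Quotient.mk _ (MvPolynomial.X 1) : ReeRing k q₀ q) ^ q
      - Ideal.Quotient.mk _ (MvPolynomial.X 1) = Ideal.Quotient.mk _ (MvPolynomial.X 0) ^ q₀ *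
        (Ideal.Quotient.mk _ (MvPolynomial.X 0) ^ q - Ideal.Quotient.mk _ (MvPolynomial.X 0)) := by
    simp only [← map_pow, ← map_sub, ← map_mul]
    rw [Ideal.Quotient.eq]
    exact Ideal.subset_span (Or.inl rfl)
  have hz : (Ideal.Quotient.mk _ (MvPolynomial.X 2) : ReeRing k q₀ q) ^ q
      - Ideal.Quotient.mk _ (MvPolynomial.X 2) = Ideal.Quotient.mk _ (MvPolynomial.X 0) ^ q₀ *
        (Ideal.Quotient.mk _ (MvPolynomial.X 1) ^ q - Ideal.Quotient.mk _ (MvPolynomial.X 1)) := by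
    simp only [← map_pow, ← map_sub, ← map_mul]
    rw [Ideal.Quotient.eq]
    exact Ideal.subset_span (Or.inr rfl)
  refine ree_main (k := k) (R := ReeRing k q₀ q) (K := ReeFunctionField k q₀ q) _ _ _ ?_
    q q₀ n (2 * n + 1) hn hqm (by omega) hy hz ?_
  · rw [eq_top_iff]
    rintro w -
    obtain ⟨p, rfl⟩ := Ideal.Quotient.mk_surjective w
    induction p using MvPolynomial.induction_on with
    | C a => exact Subalgebra.algebraMap_mem _ a
    | add p q hp hq => rw [map_add]; exact add_mem hp hq
    | mul_X p i hp =>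
      rw [map_mul]
      refine mul_mem hp (Algebra.subset_adjoin ?_)
      fin_cases i
      · exact Or.inl rfl
      · exact Or.inr (Or.inl rfl)
      · exact Or.inr (Or.inr rfl)
  · intro a b c h1 h2
    refine ⟨Ideal.Quotient.liftₐ _ (MvPolynomial.aeval ![a, b, c]) ?_, ?_, ?_, ?_⟩
    · change _ ≤ RingHom.ker (MvPolynomial.aeval (R := k) ![a, b, c])
      · rw [Ideal.span_le]
        rintro w (rfl | rfl)
        · simp [RingHom.mem_ker, h1]
        · simp [RingHom.mem_ker, h2]
    · exact MvPolynomial.aeval_X _ _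
    · exact MvPolynomial.aeval_X _ _
    · exact MvPolynomial.aeval_X _ _
end
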